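/- Let G be a vertex-minimal triangle-free, fork-free graph with chromatic number at least 4, let C be a good 5-cycle in G, and let u, v be two nonadjacent vertices of C. Then no common neighbor of u and v is adjacent to any vertex at distance exactly 2 from C. -/

import Mathlib

open SimpleGraph

/-- The fork: `K_{1,4}` with two edges subdivided. Vertex 0 is the center,
adjacent to leaves 1, 2 and to 3, 5; paths 0-3-4 and 0-5-6. -/
def fork : SimpleGraph (Fin 7) :=
  SimpleGraph.fromEdgeSet {s(0, 1), s(0, 2), s(0, 3), s(0, 5), s(3, 4), s(5, 6)}

/-- A graph is fork-free if it has no induced subgraph isomorphic to the fork. -/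
def ForkFree {V : Type} (G : SimpleGraph V) : Prop :=
  IsEmpty (fork ↪g G)

/-- `G` is a vertex-minimal triangle-free, fork-free graph with chromatic
number at least 4: every smaller triangle-free fork-free graph is 3-colorable. -/
def MinCex {V : Type} [Fintype V] (G : SimpleGraph V) : Prop :=
  G.CliqueFree 3 ∧ ForkFree G ∧ 4 ≤ G.chromaticNumber ∧
    ∀ (W : Type) [Fintype W] (H : SimpleGraph W),
      Fintype.card W < Fintype.card V → H.CliqueFree 3 → ForkFree H →
        H.chromaticNumber ≤ 3

/-- `c` describes a 5-cycle in `G`. -/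
def IsC5 {V : Type} (G : SimpleGraph V) (c : Fin 5 → V) : Prop :=
  Function.Injective c ∧ ∀ i : Fin 5, G.Adj (c i) (c (i + 1))

/-- Distance from a vertex `u` to the 5-cycle `c`. -/
noncomputable def distC {V : Type} (G : SimpleGraph V) (c : Fin 5 → V) (u : V) : ℕ :=
  Finset.univ.inf' Finset.univ_nonempty fun i => G.dist u (c i)

/-- A good 5-cycle: one minimizing the number of vertices at distance at least 2. -/
def GoodC5 {V : Type} (G : SimpleGraph V) (c : Fin 5 → V) : Prop :=
  IsC5 G c ∧ ∀ d : Fin 5 → V, IsC5 G d →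
    {u : V | 2 ≤ distC G c u}.ncard ≤ {u : V | 2 ≤ distC G d u}.ncard

namespace FK

variable {V : Type}

/-- The facts about a minimal counterexample that the proof uses. -/
structure Ctx (G : SimpleGraph V) : Prop where
  tri : ∀ {a b c : V}, G.Adj a b → G.Adj b c → ¬ G.Adj a c
  fk : ∀ F : Fin 7 → V, Function.Injective F →
    (∀ i j, G.Adj (F i) (F j) ↔ fork.Adj i j) → False
  col : ∀ S : Set V, S.Nonempty →
    ∃ κ : V → Fin 3, ∀ a b, a ∉ S → b ∉ S → G.Adj a b → κ a ≠ κ b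
  ncol : ∀ κ : V → Fin 3, ∃ a b, G.Adj a b ∧ κ a = κ b

/-- Adjacency of known vertices, read from a list of bitmask rows. -/
def adjK (rows : List ℕ) (i j : ℕ) : Bool := (rows.getD i 0).testBit j

/-- `t` is the trace of `v` on the first `n` vertices of `f`. -/
def Tr (G : SimpleGraph V) (n : ℕ) (f : ℕ → V) (v : V) (t : ℕ) : Prop :=
  ∀ j, t.testBit j = true ↔ j < n ∧ G.Adj v (f j)

/-- Vertices not covered by the known vertices in the mask `M`. -/
def uncM (G : SimpleGraph V) (f : ℕ → V) (M : ℕ) : Set V :=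
  {v | ∀ i, M.testBit i = true → v ≠ f i ∧ ¬ G.Adj v (f i)}

/-- Vertices not covered by the cycle `D`. -/
def unc (G : SimpleGraph V) (D : Fin 5 → V) : Set V :=
  {v | ∀ i, v ≠ D i ∧ ¬ G.Adj v (D i)}

structure Inv (G : SimpleGraph V) (gs rows E : List ℕ) (f : ℕ → V) : Prop where
  inj : ∀ i < rows.length, ∀ j < rows.length, f i = f j → i = j
  adj : ∀ i < rows.length, ∀ j < rows.length, (G.Adj (f i) (f j) ↔ adjK rows i j = true)
  lt : ∀ i j, adjK rows i j = true → j < rows.length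
  tr : ∀ v, (∀ i < rows.length, v ≠ f i) → ∃ t ∈ E, Tr G rows.length f v t
  good : ∀ C ∈ gs, (∀ i, C.testBit i = true → i < rows.length) ∧
    ∀ D : Fin 5 → V, IsC5 G D → (uncM G f C).ncard ≤ (unc G D).ncard

def maskOf : List ℕ → ℕ
  | [] => 0
  | i :: l => maskOf l ||| 2 ^ i

def ndp : List ℕ → Bool
  | [] => true
  | y :: l => !(l.any (Nat.beq y)) && ndp l

/-! ### Colouring leaves -/

def okc (r T m : ℕ) : Bool :=
  Nat.beq (r &&& m) 0 && (Nat.beq T 0 || !(Nat.beq (T &&& m) 0))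

def ext (rows : List ℕ) : List (ℕ × ℕ) → ℕ → ℕ → ℕ → Bool
  | [], _, _, _ => true
  | (y, T) :: xs, m0, m1, m2 =>
    (okc (rows.getD y 0) T m0 && ext rows xs (m0 ||| 2 ^ y) m1 m2) ||
    ((okc (rows.getD y 0) T m1 && ext rows xs m0 (m1 ||| 2 ^ y) m2) ||
     (okc (rows.getD y 0) T m2 && ext rows xs m0 m1 (m2 ||| 2 ^ y)))

def goodCol (rows : List ℕ) (xs : List (ℕ × ℕ)) (B X : ℕ) : List ℕ → ℕ → ℕ → ℕ → Bool
  | [], m0, m1, m2 => Nat.beq (B &&& (m0 ||| m1 ||| m2 ||| X)) B && ext rows xs m0 m1 m2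
  | v :: t, m0, m1, m2 =>
    (Nat.beq (B &&& (m0 ||| m1 ||| m2 ||| X)) B && ext rows xs m0 m1 m2) ||
    ((!(Nat.beq (rows.getD v 0 &&& m0) 0) || goodCol rows xs B X t (m0 ||| 2 ^ v) m1 m2) &&
     ((!(Nat.beq (rows.getD v 0 &&& m1) 0) || goodCol rows xs B X t m0 (m1 ||| 2 ^ v) m2) &&
      (!(Nat.beq (rows.getD v 0 &&& m2) 0) || goodCol rows xs B X t m0 m1 (m2 ||| 2 ^ v))))

def maskB (rows : List ℕ) : List (ℕ × ℕ) → ℕ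
  | [] => 0
  | (y, _) :: xs => maskB rows xs ||| rows.getD y 0

def chkX (rows E : List ℕ) (xs : List (ℕ × ℕ)) (ord : List ℕ) : Bool :=
  !xs.isEmpty && (ndp (xs.map Prod.fst) &&
  (xs.all (fun p => Nat.blt p.1 rows.length && (Nat.beq (p.2 &&& maskOf (xs.map Prod.fst)) 0 &&
    E.all (fun e => !(e.testBit p.1) || (!(Nat.beq p.2 0) && Nat.beq (p.2 &&& e) p.2)))) &&
  (ord.all (fun v => Nat.blt v rows.length && !((maskOf (xs.map Prod.fst)).testBit v)) &&
  goodCol rows xs (maskB rows xs) (maskOf (xs.map Prod.fst)) ord 0 0 0)))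

/-! ### Good-cycle leaves -/

def cov1 (rows : List ℕ) (M i : ℕ) : Bool := M.testBit i || !(Nat.beq (rows.getD i 0 &&& M) 0)

def chkG (gs rows E : List ℕ) (C : ℕ) : List ℕ → Bool
  | [d0, d1, d2, d3, d4] =>
    gs.any (Nat.beq C) && (ndp [d0, d1, d2, d3, d4] &&
    ([d0, d1, d2, d3, d4].all (fun d => Nat.blt d rows.length) &&
    ((adjK rows d0 d1 && (adjK rows d1 d2 && (adjK rows d2 d3 && (adjK rows d3 d4 && adjK rows d4 d0)))) &&
    (E.all (fun e => Nat.beq (e &&& C) 0 || !(Nat.beq (e &&& maskOf [d0, d1, d2, d3, d4]) 0)) &&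
    Nat.blt
      ((List.range rows.length).filter
        (fun i => cov1 rows C i && !(cov1 rows (maskOf [d0, d1, d2, d3, d4]) i))).length
      ((List.range rows.length).filter
        (fun i => cov1 rows (maskOf [d0, d1, d2, d3, d4]) i && !(cov1 rows C i))).length))))
  | _ => false

/-! ### Fork filters -/

def fidx (F k : ℕ) : ℕ := F / 100 ^ k % 100

def isE (i j : ℕ) : Bool :=
  (Nat.beq i 0 && (Nat.beq j 1 || (Nat.beq j 2 || (Nat.beq j 3 || Nat.beq j 5)))) ||
  ((Nat.beq i 3 && Nat.beq j 4) || (Nat.beq i 5 && Nat.beq j 6))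

def prs : List (ℕ × ℕ) :=
  [(0,1),(0,2),(0,3),(0,4),(0,5),(0,6),(1,2),(1,3),(1,4),(1,5),(1,6),(2,3),(2,4),(2,5),(2,6),
   (3,4),(3,5),(3,6),(4,5),(4,6),(5,6)]

def forkPre (rows : List ℕ) (n F : ℕ) : Bool :=
  prs.all (fun p => !(Nat.beq (fidx F p.1) (fidx F p.2)) &&
    (Nat.ble (fidx F p.1) n && (Nat.ble (fidx F p.2) n &&
    (Nat.beq (fidx F p.1) n || (Nat.beq (fidx F p.2) n ||
      (adjK rows (fidx F p.1) (fidx F p.2) == isE p.1 p.2))))))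

def fmask (n F : ℕ) (e : Bool) : List (ℕ × ℕ) → ℕ
  | [] => 0
  | (i, j) :: l =>
    bif isE i j == e then
      (bif Nat.beq (fidx F i) n then fmask n F e l ||| 2 ^ (fidx F j)
       else bif Nat.beq (fidx F j) n then fmask n F e l ||| 2 ^ (fidx F i) else fmask n F e l)
    else fmask n F e l

def filt1 (rows : List ℕ) (F : ℕ) (E : List ℕ) : List ℕ :=
  bif forkPre rows rows.length F then
    E.filter (fun t => !(Nat.beq (t &&& fmask rows.length F true prs) (fmask rows.length F true prs)
      && Nat.beq (t &&& fmask rows.length F false prs) 0))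
  else E

def filtF (rows : List ℕ) : List ℕ → List ℕ → List ℕ
  | [], E => E
  | F :: fk, E => filtF rows fk (filt1 rows F E)

def addGo (s n : ℕ) : ℕ → List ℕ → List ℕ
  | _, [] => [s]
  | i, r :: rs => (bif s.testBit i then r ||| 2 ^ n else r) :: addGo s n (i + 1) rs

def addv (rows : List ℕ) (s : ℕ) : List ℕ := addGo s rows.length 0 rows

def expand (n s : ℕ) (E : List ℕ) : List ℕ :=
  E ++ (E.filter (fun t => Nat.beq (t &&& s) 0)).map (fun t => t ||| 2 ^ n)

def childE (rows E : List ℕ) (s : ℕ) (fk : List ℕ) : List ℕ :=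
  filtF (addv rows s) fk (expand rows.length s E)

inductive Cert where
  | X (xs : List (ℕ × ℕ)) (ord : List ℕ) : Cert
  | good (C : ℕ) (D : List ℕ) : Cert
  | cut (s : ℕ) (fk : List ℕ) (sub next : Cert) : Cert

def check (gs : List ℕ) : Cert → List ℕ → List ℕ → Bool
  | .X xs ord, rows, E => chkX rows E xs ord
  | .good C D, rows, E => chkG gs rows E C D
  | .cut s fk sub next, rows, E =>
    check gs sub (addv rows s) (childE rows E s fk) &&
    check gs next rows (E.filter (fun t => !(Nat.beq t s)))

def rootE (rows : List ℕ) : List ℕ :=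
  (List.range (2 ^ rows.length)).filter (fun t =>
    (List.range rows.length).all (fun i => !(t.testBit i) || Nat.beq (t &&& rows.getD i 0) 0))

def rowsA : List ℕ := [50, 133, 42, 20, 9, 69, 160, 66]
def rowsB : List ℕ := [50, 133, 42, 20, 9, 69, 32, 2]

/-! ### Soundness of the colouring leaf -/

lemma land_beq_zero {a b : ℕ} (h : Nat.beq (a &&& b) 0 = true) (i : ℕ) (ha : a.testBit i = true) :
    b.testBit i = false := by
  have h' := Nat.eq_of_beq_eq_true h
  have := congrArg (fun x => Nat.testBit x i) h'
  simpa [Nat.testBit_and, ha] using this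

lemma land_bne_zero {a b : ℕ} (h : Nat.beq (a &&& b) 0 = false) :
    ∃ i, a.testBit i = true ∧ b.testBit i = true := by
  by_contra hcon
  push Not at hcon
  have : a &&& b = 0 := by
    apply Nat.eq_of_testBit_eq
    intro i
    have := hcon i
    simp only [Nat.testBit_and, Nat.zero_testBit]
    cases h1 : a.testBit i <;> simp_all
  rw [this] at h
  simp at h

lemma land_beq_left {a b : ℕ} (h : Nat.beq (a &&& b) a = true) (i : ℕ) (ha : a.testBit i = true) :
    b.testBit i = true := by
  have h' := Nat.eq_of_beq_eq_true h
  have := congrArg (fun x => Nat.testBit x i) h'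
  simpa [Nat.testBit_and, ha] using this

lemma testBit_or_pow (m y i : ℕ) :
    (m ||| 2 ^ y).testBit i = true ↔ m.testBit i = true ∨ i = y := by
  rw [Nat.testBit_or, Nat.testBit_two_pow, Bool.or_eq_true, decide_eq_true_iff,
    @eq_comm _ y i]

lemma testBit_maskOf (l : List ℕ) (i : ℕ) : (maskOf l).testBit i = true ↔ i ∈ l := by
  induction l with
  | nil => simp [maskOf]
  | cons a l ih => rw [maskOf, testBit_or_pow, ih]; simp [or_comm]

lemma ndp_nodup (l : List ℕ) (h : ndp l = true) : l.Nodup := by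
  induction l with
  | nil => simp
  | cons a l ih =>
    simp only [ndp, Bool.and_eq_true, Bool.not_eq_true', List.any_eq_false] at h
    refine List.nodup_cons.2 ⟨fun hm => ?_, ih h.2⟩
    exact h.1 a hm (by simp)

def ExtGood (rows : List ℕ) (xs : List (ℕ × ℕ)) (M : Fin 3 → ℕ) (χ : ℕ → Fin 3) : Prop :=
  (∀ p ∈ xs, ∀ i, (M (χ p.1)).testBit i = true → adjK rows p.1 i = false) ∧
  (∀ p ∈ xs, p.2 ≠ 0 → ∃ z, p.2.testBit z = true ∧
    ((M (χ p.1)).testBit z = true ∨ z ∈ xs.map Prod.fst)) ∧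
  (∀ p ∈ xs, ∀ q ∈ xs, p.1 ≠ q.1 → adjK rows p.1 q.1 = true → adjK rows q.1 p.1 = true →
    χ p.1 ≠ χ q.1)

lemma ext_aux (rows : List ℕ) (y T : ℕ) (xs : List (ℕ × ℕ)) (M M' : Fin 3 → ℕ) (c : Fin 3)
    (hM : ∀ d i, (M' d).testBit i = true ↔ (M d).testBit i = true ∨ (d = c ∧ i = y))
    (hc : okc (rows.getD y 0) T (M c) = true) (hy : y ∉ xs.map Prod.fst)
    (ih : ∃ χ, ExtGood rows xs M' χ) : ∃ χ, ExtGood rows ((y, T) :: xs) M χ := by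
  obtain ⟨χ, h1, h2, h3⟩ := ih
  simp only [okc, Bool.and_eq_true, Bool.or_eq_true, Bool.not_eq_true'] at hc
  have hne : ∀ p ∈ xs, p.1 ≠ y := fun p hp h => hy (h ▸ List.mem_map_of_mem hp)
  refine ⟨fun i => if i = y then c else χ i, ?_, ?_, ?_⟩
  · intro p hp i hi
    rcases List.mem_cons.1 hp with rfl | hp
    · simp only [if_true] at hi
      by_contra hcon
      rw [Bool.not_eq_false] at hcon
      have := land_beq_zero hc.1 i hcon
      simp_all
    · simp only [hne p hp, if_false] at hi
      exact h1 p hp i ((hM _ _).2 (Or.inl hi))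
  · intro p hp hT
    rcases List.mem_cons.1 hp with rfl | hp
    · simp only [if_true]
      rcases hc.2 with h | h
      · exact absurd (Nat.eq_of_beq_eq_true h) hT
      · obtain ⟨z, hz, hz'⟩ := land_bne_zero h
        exact ⟨z, hz, Or.inl hz'⟩
    · simp only [hne p hp, if_false]
      obtain ⟨z, hz, hz'⟩ := h2 p hp hT
      refine ⟨z, hz, ?_⟩
      rcases hz' with h | h
      · rcases (hM _ _).1 h with h | h
        · exact Or.inl h
        · right; simp [h.2]
      · right; simp only [List.map_cons, List.mem_cons]; exact Or.inr h
  · intro p hp q hq hpq ha hb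
    rcases List.mem_cons.1 hp with rfl | hp <;> rcases List.mem_cons.1 hq with rfl | hq
    · exact absurd rfl hpq
    · simp only [if_true, hne q hq, if_false]
      intro h
      have := h1 q hq y ((hM _ _).2 (Or.inr ⟨h.symm, rfl⟩))
      simp_all
    · simp only [if_true, hne p hp, if_false]
      intro h
      have := h1 p hp y ((hM _ _).2 (Or.inr ⟨h, rfl⟩))
      simp_all
    · simp only [hne p hp, hne q hq, if_false]
      exact h3 p hp q hq hpq ha hb

lemma upd0 (m0 m1 m2 y : ℕ) (d : Fin 3) (i : ℕ) :
    ((![m0 ||| 2 ^ y, m1, m2] : Fin 3 → ℕ) d).testBit i = true ↔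
      ((![m0, m1, m2] : Fin 3 → ℕ) d).testBit i = true ∨ (d = 0 ∧ i = y) := by
  fin_cases d <;> simp [testBit_or_pow, -Nat.testBit_or]

lemma upd1 (m0 m1 m2 y : ℕ) (d : Fin 3) (i : ℕ) :
    ((![m0, m1 ||| 2 ^ y, m2] : Fin 3 → ℕ) d).testBit i = true ↔
      ((![m0, m1, m2] : Fin 3 → ℕ) d).testBit i = true ∨ (d = 1 ∧ i = y) := by
  fin_cases d <;> simp [testBit_or_pow, -Nat.testBit_or]

lemma upd2 (m0 m1 m2 y : ℕ) (d : Fin 3) (i : ℕ) :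
    ((![m0, m1, m2 ||| 2 ^ y] : Fin 3 → ℕ) d).testBit i = true ↔
      ((![m0, m1, m2] : Fin 3 → ℕ) d).testBit i = true ∨ (d = 2 ∧ i = y) := by
  fin_cases d <;> simp [testBit_or_pow, -Nat.testBit_or]

lemma ext_sound (rows : List ℕ) (xs : List (ℕ × ℕ)) : ∀ m0 m1 m2 : ℕ,
    ext rows xs m0 m1 m2 = true → (xs.map Prod.fst).Nodup →
    ∃ χ, ExtGood rows xs ![m0, m1, m2] χ := by
  induction xs with
  | nil => intro m0 m1 m2 _ _; exact ⟨fun _ => 0, by simp [ExtGood]⟩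
  | cons p xs ih =>
    obtain ⟨y, T⟩ := p
    intro m0 m1 m2 h hn
    simp only [List.map_cons, List.nodup_cons] at hn
    simp only [ext, Bool.or_eq_true, Bool.and_eq_true] at h
    rcases h with h | h | h
    · exact ext_aux rows y T xs _ _ 0 (upd0 m0 m1 m2 y) h.1 hn.1 (ih _ _ _ h.2 hn.2)
    · exact ext_aux rows y T xs _ _ 1 (upd1 m0 m1 m2 y) h.1 hn.1 (ih _ _ _ h.2 hn.2)
    · exact ext_aux rows y T xs _ _ 2 (upd2 m0 m1 m2 y) h.1 hn.1 (ih _ _ _ h.2 hn.2)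

def ColInv (n X : ℕ) (κ : ℕ → Fin 3) (M : Fin 3 → ℕ) : Prop :=
  ∀ c i, (M c).testBit i = true → i < n ∧ X.testBit i = false ∧ κ i = c

lemma goodCol_sound (rows : List ℕ) (xs : List (ℕ × ℕ)) (B X n : ℕ) (κ : ℕ → Fin 3)
    (hκ : ∀ i < n, ∀ j < n, X.testBit i = false → X.testBit j = false →
      adjK rows i j = true → κ i ≠ κ j) (ord : List ℕ) :
    ∀ m0 m1 m2 : ℕ, (∀ v ∈ ord, v < n ∧ X.testBit v = false) →
    ColInv n X κ ![m0, m1, m2] → goodCol rows xs B X ord m0 m1 m2 = true →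
    ∃ m0 m1 m2 : ℕ, ColInv n X κ ![m0, m1, m2] ∧
      Nat.beq (B &&& (m0 ||| m1 ||| m2 ||| X)) B = true ∧ ext rows xs m0 m1 m2 = true := by
  induction ord with
  | nil =>
    intro m0 m1 m2 _ hI h
    simp only [goodCol, Bool.and_eq_true] at h
    exact ⟨m0, m1, m2, hI, h.1, h.2⟩
  | cons v t ih =>
    intro m0 m1 m2 hord hI h
    rw [goodCol, Bool.or_eq_true, Bool.and_eq_true] at h
    rcases h with h | h
    · exact ⟨m0, m1, m2, hI, h.1, h.2⟩
    · have hv := hord v (by simp)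
      have ht : ∀ w ∈ t, w < n ∧ X.testBit w = false := fun w hw => hord w (by simp [hw])
      simp only [Bool.and_eq_true, Bool.or_eq_true, Bool.not_eq_true'] at h
      have key : ∀ c, κ v = c → Nat.beq (rows.getD v 0 &&& (![m0, m1, m2] : Fin 3 → ℕ) c) 0 = false →
          False := by
        intro c hc hb
        obtain ⟨i, h1, h2⟩ := land_bne_zero hb
        obtain ⟨hi, hiX, hic⟩ := hI c i h2
        exact hκ v hv.1 i hi hv.2 hiX h1 (by rw [hc, hic])
      obtain ⟨h0, h1, h2⟩ := h
      have fin3 : κ v = 0 ∨ κ v = 1 ∨ κ v = 2 := by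
        generalize κ v = c
        fin_cases c <;> simp
      rcases fin3 with hc | hc | hc
      · rcases h0 with h0 | h0
        · exact (key 0 hc h0).elim
        · refine ih _ _ _ ht ?_ h0
          intro c i hi
          rcases (upd0 m0 m1 m2 v c i).1 hi with hi | ⟨rfl, rfl⟩
          · exact hI c i hi
          · exact ⟨hv.1, hv.2, hc⟩
      · rcases h1 with h1 | h1
        · exact (key 1 hc h1).elim
        · refine ih _ _ _ ht ?_ h1
          intro c i hi
          rcases (upd1 m0 m1 m2 v c i).1 hi with hi | ⟨rfl, rfl⟩
          · exact hI c i hi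
          · exact ⟨hv.1, hv.2, hc⟩
      · rcases h2 with h2 | h2
        · exact (key 2 hc h2).elim
        · refine ih _ _ _ ht ?_ h2
          intro c i hi
          rcases (upd2 m0 m1 m2 v c i).1 hi with hi | ⟨rfl, rfl⟩
          · exact hI c i hi
          · exact ⟨hv.1, hv.2, hc⟩

lemma testBit_maskB (rows : List ℕ) (xs : List (ℕ × ℕ)) (p : ℕ × ℕ) (hp : p ∈ xs) (i : ℕ)
    (h : adjK rows p.1 i = true) : (maskB rows xs).testBit i = true := by
  induction xs with
  | nil => simp at hp
  | cons q xs ih =>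
    rw [maskB, Nat.testBit_or, Bool.or_eq_true]
    rcases List.mem_cons.1 hp with rfl | hp
    · exact Or.inr h
    · exact Or.inl (ih hp)

lemma chkX_sound {G : SimpleGraph V} (hG : Ctx G) {gs rows E : List ℕ} {f : ℕ → V}
    (hI : Inv G gs rows E f) (xs : List (ℕ × ℕ)) (ord : List ℕ)
    (h : chkX rows E xs ord = true) : False := by
  classical
  simp only [chkX, Bool.and_eq_true, Bool.not_eq_true', List.all_eq_true, Bool.or_eq_true] at h
  obtain ⟨hne, hnd, hxs, hord, hgc⟩ := h
  have hnd' := ndp_nodup _ hnd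
  set XL := xs.map Prod.fst with hXL
  have hXlt : ∀ y ∈ XL, y < rows.length := by
    intro y hy
    obtain ⟨p, hp, rfl⟩ := List.mem_map.1 hy
    have := (hxs p hp).1
    simpa [Nat.blt_eq] using this
  let S : Set V := {v | ∃ y ∈ XL, v = f y}
  have hSne : S.Nonempty := by
    cases xs with
    | nil => simp at hne
    | cons p xs => exact ⟨f p.1, p.1, by simp [hXL], rfl⟩
  obtain ⟨κ, hκ⟩ := hG.col S hSne
  have hXb : ∀ i, (maskOf XL).testBit i = false ↔ i ∉ XL := by
    intro i
    rw [← testBit_maskOf]; simp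
  have hnS : ∀ i < rows.length, i ∉ XL → f i ∉ S := by
    rintro i hi hiX ⟨y, hy, hfy⟩
    exact hiX (hI.inj i hi y (hXlt y hy) hfy ▸ hy)
  obtain ⟨m0, m1, m2, hC, hB, hext⟩ := goodCol_sound rows xs _ (maskOf XL) rows.length
    (fun i => κ (f i)) (by
      intro i hi j hj hiX hjX hadj
      exact hκ _ _ (hnS i hi ((hXb i).1 hiX)) (hnS j hj ((hXb j).1 hjX))
        ((hI.adj i hi j hj).2 hadj)) ord 0 0 0 (by
      intro v hv
      have := hord v hv
      simpa [Nat.blt_eq] using this) (by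
      intro c i hi
      fin_cases c <;> simp at hi) hgc
  obtain ⟨χ, h1, h2, h3⟩ := ext_sound rows xs m0 m1 m2 hext hnd'
  let ψ : V → Fin 3 := fun v => if h : ∃ y ∈ XL, v = f y then χ h.choose else κ v
  have hψX : ∀ y ∈ XL, ψ (f y) = χ y := by
    intro y hy
    have hex : ∃ y' ∈ XL, f y = f y' := ⟨y, hy, rfl⟩
    have hs := hex.choose_spec
    have : hex.choose = y := (hI.inj _ (hXlt _ hy) _ (hXlt _ hs.1) hs.2).symm
    simp only [ψ, dif_pos hex, this]
  have hψn : ∀ v, v ∉ S → ψ v = κ v := by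
    intro v hv
    have hv' : ¬ ∃ y ∈ XL, v = f y := hv
    simp only [ψ]
    rw [dif_neg hv']
  have cross : ∀ y ∈ XL, ∀ v, v ∉ S → G.Adj (f y) v → ψ (f y) ≠ ψ v := by
    intro y hy v hv hadj heq
    rw [hψX y hy, hψn v hv] at heq
    obtain ⟨p, hp, rfl⟩ := List.mem_map.1 hy
    by_cases hk : ∃ i < rows.length, v = f i
    · obtain ⟨i, hi, rfl⟩ := hk
      have ha := (hI.adj _ (hXlt _ hy) i hi).1 hadj
      have hb := land_beq_left hB i (testBit_maskB rows xs p hp i ha)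
      have hiX : i ∉ XL := fun hiX => hv ⟨i, hiX, rfl⟩
      have hc : ∃ c : Fin 3, ((![m0, m1, m2] : Fin 3 → ℕ) c).testBit i = true := by
        simp only [Nat.testBit_or, Bool.or_eq_true, testBit_maskOf] at hb
        rcases hb with ((hb | hb) | hb) | hb
        · exact ⟨0, hb⟩
        · exact ⟨1, hb⟩
        · exact ⟨2, hb⟩
        · exact absurd hb hiX
      obtain ⟨c, hc⟩ := hc
      have hic := (hC c i hc).2.2
      have := h1 p hp i (by rw [heq]; rw [← hic] at hc; exact hc)
      rw [this] at ha
      exact Bool.noConfusion ha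
    · push Not at hk
      obtain ⟨t, htE, ht⟩ := hI.tr v hk
      have hty : t.testBit p.1 = true := (ht p.1).2 ⟨hXlt _ hy, hadj.symm⟩
      have hp' := hxs p hp
      have hte := hp'.2.2 t htE
      rcases hte with hte | ⟨hT0, hTt⟩
      · rw [hty] at hte; exact Bool.noConfusion hte
      · have hT : p.2 ≠ 0 := by
          intro h0; rw [h0] at hT0; simp at hT0
        obtain ⟨z, hz, hz'⟩ := h2 p hp hT
        have hzX : z ∉ XL := (hXb z).1 (land_beq_zero hp'.2.1 z hz)
        rcases hz' with hz' | hz'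
        · have hzz := hC _ z hz'
          have hvz : G.Adj v (f z) := ((ht z).1 (land_beq_left hTt z hz)).2
          exact hκ v (f z) hv (hnS z hzz.1 hzX) hvz (by rw [← heq]; exact hzz.2.2.symm)
        · exact hzX hz'
  obtain ⟨a, b, hab, hcol⟩ := hG.ncol ψ
  by_cases ha : a ∈ S <;> by_cases hb : b ∈ S
  · obtain ⟨y, hy, rfl⟩ := ha
    obtain ⟨y', hy', rfl⟩ := hb
    rw [hψX y hy, hψX y' hy'] at hcol
    have hne' : y ≠ y' := by rintro rfl; exact G.irrefl hab
    have e1 := (hI.adj _ (hXlt _ hy) _ (hXlt _ hy')).1 hab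
    have e2 := (hI.adj _ (hXlt _ hy') _ (hXlt _ hy)).1 hab.symm
    obtain ⟨p, hp, rfl⟩ := List.mem_map.1 hy
    obtain ⟨q, hq, rfl⟩ := List.mem_map.1 hy'
    exact h3 p hp q hq hne' e1 e2 hcol
  · obtain ⟨y, hy, rfl⟩ := ha
    exact cross y hy b hb hab hcol
  · obtain ⟨y, hy, rfl⟩ := hb
    exact cross y hy a ha hab.symm hcol.symm
  · rw [hψn a ha, hψn b hb] at hcol
    exact hκ a b ha hb hab hcol

/-! ### Soundness of the good-cycle leaf -/

lemma nbeq_false {a b : ℕ} (h : a ≠ b) : Nat.beq a b = false :=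
  Bool.eq_false_iff.2 fun hc => h (Nat.eq_of_beq_eq_true hc)

lemma cov1_iff {G : SimpleGraph V} {gs rows E : List ℕ} {f : ℕ → V}
    (hI : Inv G gs rows E f) (M : ℕ) (hM : ∀ i, M.testBit i = true → i < rows.length)
    (i : ℕ) (hi : i < rows.length) : cov1 rows M i = false ↔ f i ∈ uncM G f M := by
  simp only [cov1, Bool.or_eq_false_iff, Bool.not_eq_false', uncM, Set.mem_ofPred_eq]
  constructor
  · rintro ⟨h1, h2⟩ k hk
    refine ⟨fun h => ?_, fun h => ?_⟩
    · have := hI.inj i hi k (hM k hk) h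
      subst this; simp_all
    · have ha := (hI.adj i hi k (hM k hk)).1 h
      have := land_beq_zero h2 k ha
      simp_all
  · intro h
    constructor
    · by_contra hc
      exact (h i (by simpa using hc)).1 rfl
    · by_contra hc
      obtain ⟨k, h1, h2⟩ := land_bne_zero (Bool.eq_false_iff.2 hc)
      exact (h k h2).2 ((hI.adj i hi k (hM k h2)).2 h1)

lemma chkG_sound [Fintype V] {G : SimpleGraph V} {gs rows E : List ℕ} {f : ℕ → V}
    (hI : Inv G gs rows E f) (C : ℕ) (D : List ℕ)
    (h : chkG gs rows E C D = true) : False := by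
  classical
  unfold chkG at h
  split at h
  swap
  · exact Bool.noConfusion h
  rename_i d0 d1 d2 d3 d4
  simp only [Bool.and_eq_true, List.all_eq_true, Bool.or_eq_true, Bool.not_eq_true'] at h
  obtain ⟨hC, hnd, hlt, ⟨a0, a1, a2, a3, a4⟩, hE, hcnt⟩ := h
  obtain ⟨C', hC', hCC⟩ := List.any_eq_true.1 hC
  obtain rfl : C = C' := Nat.eq_of_beq_eq_true hCC
  obtain ⟨hCb, hgood⟩ := hI.good C hC'
  have hnd' := ndp_nodup _ hnd
  set DL := [d0, d1, d2, d3, d4] with hDL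
  have hlt' : ∀ d ∈ DL, d < rows.length := fun d hd => by
    simpa [Nat.blt_eq] using hlt d hd
  have l0 : d0 < rows.length := hlt' d0 (by simp [hDL])
  have l1 : d1 < rows.length := hlt' d1 (by simp [hDL])
  have l2 : d2 < rows.length := hlt' d2 (by simp [hDL])
  have l3 : d3 < rows.length := hlt' d3 (by simp [hDL])
  have l4 : d4 < rows.length := hlt' d4 (by simp [hDL])
  have hMb : ∀ i, (maskOf DL).testBit i = true → i < rows.length := fun i hi =>
    hlt' i ((testBit_maskOf _ _).1 hi)
  let Df : Fin 5 → V := ![f d0, f d1, f d2, f d3, f d4]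
  have hDf : IsC5 G Df := by
    constructor
    · have hn : Function.Injective (![d0, d1, d2, d3, d4] : Fin 5 → ℕ) := by
        have : (List.ofFn (![d0, d1, d2, d3, d4] : Fin 5 → ℕ)).Nodup := by
          simpa [hDL, List.ofFn_succ] using hnd'
        exact List.nodup_ofFn.1 this
      have e : Df = fun i => f ((![d0, d1, d2, d3, d4] : Fin 5 → ℕ) i) := by
        funext i; fin_cases i <;> rfl
      have hl : ∀ i, (![d0, d1, d2, d3, d4] : Fin 5 → ℕ) i < rows.length := by
        intro i; fin_cases i <;> assumption
      intro i j hij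
      rw [e] at hij
      exact hn (hI.inj _ (hl i) _ (hl j) hij)
    · intro i
      fin_cases i
      · exact (hI.adj _ l0 _ l1).2 a0
      · exact (hI.adj _ l1 _ l2).2 a1
      · exact (hI.adj _ l2 _ l3).2 a2
      · exact (hI.adj _ l3 _ l4).2 a3
      · exact (hI.adj _ l4 _ l0).2 a4
  have hunc : unc G Df = uncM G f (maskOf DL) := by
    ext v
    simp only [unc, uncM, Set.mem_ofPred_eq, testBit_maskOf, hDL, Fin.forall_fin_succ, Df]
    simp
  set A := (List.range rows.length).filter
    (fun i => cov1 rows (maskOf DL) i && !(cov1 rows C i)) with hA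
  set B := (List.range rows.length).filter
    (fun i => cov1 rows C i && !(cov1 rows (maskOf DL) i)) with hB
  have hAm : ∀ i, i ∈ A ↔ i < rows.length ∧ cov1 rows (maskOf DL) i = true ∧ cov1 rows C i = false := by
    intro i; simp [hA]
  have hBm : ∀ i, i ∈ B ↔ i < rows.length ∧ cov1 rows C i = true ∧ cov1 rows (maskOf DL) i = false := by
    intro i; simp [hB]
  let SA : Set V := f '' {i | i ∈ A}
  let SB : Set V := f '' {i | i ∈ B}
  have hsub : unc G Df ⊆ (uncM G f C \ SA) ∪ SB := by
    intro v hv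
    rw [hunc] at hv
    by_cases hk : ∃ i < rows.length, v = f i
    · obtain ⟨i, hi, rfl⟩ := hk
      have hcd := (cov1_iff hI _ hMb i hi).2 hv
      by_cases hcc : cov1 rows C i = true
      · exact Or.inr ⟨i, (hBm i).2 ⟨hi, hcc, hcd⟩, rfl⟩
      · left
        refine ⟨(cov1_iff hI _ hCb i hi).1 (by simpa using hcc), ?_⟩
        rintro ⟨k, hk, hki⟩
        have hk' := (hAm k).1 hk
        have := hI.inj k hk'.1 i hi hki
        subst this
        rw [hcd] at hk'
        exact Bool.noConfusion hk'.2.1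
    · push Not at hk
      left
      obtain ⟨t, ht, htr⟩ := hI.tr v hk
      refine ⟨?_, ?_⟩
      · rcases hE t ht with h0 | h0
        · intro i hi
          refine ⟨hk i (hCb i hi), fun hadj => ?_⟩
          have := land_beq_zero h0 i ((htr i).2 ⟨hCb i hi, hadj⟩)
          simp_all
        · obtain ⟨k, hk1, hk2⟩ := land_bne_zero h0
          exact absurd ((htr k).1 hk1).2 (hv k hk2).2
      · rintro ⟨k, hk', hki⟩
        exact hk k ((hAm k).1 hk').1 hki.symm
  have hSA : SA ⊆ uncM G f C := by
    rintro _ ⟨i, hi, rfl⟩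
    have hi' := (hAm i).1 hi
    exact (cov1_iff hI _ hCb i hi'.1).1 hi'.2.2
  have hAc : SA.ncard = A.length := by
    have h1 : SA = ((A.toFinset.image f : Finset V) : Set V) := by
      ext v; simp [SA]
    rw [h1, Set.ncard_coe_finset, Finset.card_image_of_injOn, List.toFinset_card_of_nodup]
    · exact List.Nodup.filter _ List.nodup_range
    · intro i hi j hj hij
      have hi' := (hAm i).1 (by simpa using hi)
      have hj' := (hAm j).1 (by simpa using hj)
      exact hI.inj i hi'.1 j hj'.1 hij
  have hBc : SB.ncard ≤ B.length := by
    have h1 : SB = ((B.toFinset.image f : Finset V) : Set V) := by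
      ext v; simp [SB]
    rw [h1, Set.ncard_coe_finset]
    exact Finset.card_image_le.trans (List.toFinset_card_le _)
  have hcnt' : B.length < A.length := by simpa [Nat.blt_eq] using hcnt
  have c1 := hgood Df hDf
  have c2 := Set.ncard_le_ncard hsub (Set.toFinite _)
  have c3 := Set.ncard_union_le (uncM G f C \ SA) SB
  have c4 := Set.ncard_sdiff_add_ncard_of_subset hSA (Set.toFinite _)
  omega

/-! ### Soundness of the fork filter -/

lemma fmask_true (n F : ℕ) (e : Bool) (l : List (ℕ × ℕ)) (i j : ℕ) (h : (i, j) ∈ l)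
    (hne : fidx F i ≠ fidx F j) (he : isE i j = e) :
    (fidx F i = n → (fmask n F e l).testBit (fidx F j) = true) ∧
    (fidx F j = n → (fmask n F e l).testBit (fidx F i) = true) := by
  induction l with
  | nil => simp at h
  | cons p l ih =>
    obtain ⟨a, b⟩ := p
    have mono : ∀ k, (fmask n F e l).testBit k = true →
        (fmask n F e ((a, b) :: l)).testBit k = true := by
      intro k hk
      rw [fmask]
      cases h1 : (isE a b == e) <;> cases h2 : Nat.beq (fidx F a) n <;>
        cases h3 : Nat.beq (fidx F b) n <;>
        simp only [cond_true, cond_false, testBit_or_pow, hk, true_or]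
    rcases List.mem_cons.1 h with h | h
    · obtain ⟨rfl, rfl⟩ := Prod.mk.inj h
      rw [fmask]
      have : (isE i j == e) = true := by simp [he]
      rw [this, cond_true]
      constructor
      · intro h1
        have : Nat.beq (fidx F i) n = true := by rw [h1]; simp
        rw [this, cond_true, testBit_or_pow]; right; rfl
      · intro h1
        have h2 : Nat.beq (fidx F i) n = false := by
          rw [← h1]; exact nbeq_false hne
        have h3 : Nat.beq (fidx F j) n = true := by rw [h1]; simp
        rw [h2, cond_false, h3, cond_true, testBit_or_pow]; right; rfl
    · exact ⟨fun h1 => mono _ ((ih h).1 h1), fun h1 => mono _ ((ih h).2 h1)⟩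

lemma prs_mem : ∀ i j : Fin 7, i < j → ((i : ℕ), (j : ℕ)) ∈ prs := by decide

lemma fork_isE (i j : Fin 7) (h : i < j) : fork.Adj i j ↔ isE i j = true := by
  have hne : i ≠ j := ne_of_lt h
  simp only [fork, SimpleGraph.fromEdgeSet_adj, Set.mem_insert_iff, Set.mem_singleton_iff]
  revert i j
  decide

/-- A fork among known vertices and `v` is impossible. -/
lemma fork_kill {G : SimpleGraph V} (hG : Ctx G) {gs rows E : List ℕ} {f : ℕ → V}
    (hI : Inv G gs rows E f) (F : ℕ) (hF : forkPre rows rows.length F = true) (v : V)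
    (hv : ∀ i < rows.length, v ≠ f i) (t : ℕ) (ht : Tr G rows.length f v t)
    (hP : Nat.beq (t &&& fmask rows.length F true prs) (fmask rows.length F true prs) = true)
    (hQ : Nat.beq (t &&& fmask rows.length F false prs) 0 = true) : False := by
  classical
  set n := rows.length with hn
  let g : ℕ → V := fun i => if i = n then v else f i
  have hpre : ∀ i j : Fin 7, i < j → fidx F i ≠ fidx F j ∧ fidx F i ≤ n ∧ fidx F j ≤ n ∧
      (fidx F i = n ∨ fidx F j = n ∨ adjK rows (fidx F i) (fidx F j) = isE i j) := by
    intro i j hij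
    have := (List.all_eq_true.1 hF) _ (prs_mem i j hij)
    simp only [Bool.and_eq_true, Bool.or_eq_true, Bool.not_eq_true', beq_iff_eq] at this
    obtain ⟨h1, h2, h3, h4⟩ := this
    refine ⟨fun h => ?_, Nat.le_of_ble_eq_true h2, Nat.le_of_ble_eq_true h3, ?_⟩
    · simp only [h, Nat.beq_refl] at h1
      exact Bool.noConfusion h1
    · rcases h4 with h4 | h4 | h4
      · exact Or.inl (Nat.eq_of_beq_eq_true h4)
      · exact Or.inr (Or.inl (Nat.eq_of_beq_eq_true h4))
      · exact Or.inr (Or.inr h4)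
  have key : ∀ i j : Fin 7, i < j → g (fidx F i) ≠ g (fidx F j) ∧
      (G.Adj (g (fidx F i)) (g (fidx F j)) ↔ fork.Adj i j) := by
    intro i j hij
    obtain ⟨hne, hi, hj, hor⟩ := hpre i j hij
    rw [fork_isE i j hij]
    have tb : ∀ k, k ≤ n → k ≠ n → (t.testBit k = true ↔ G.Adj v (f k)) := by
      intro k hk hk'
      rw [ht k]
      exact ⟨fun h => h.2, fun h => ⟨by omega, h⟩⟩
    have hPQ : ∀ k, ((isE i j = true → (fmask n F true prs).testBit k = true)) →
        ((isE i j = false → (fmask n F false prs).testBit k = true)) →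
        (t.testBit k = true ↔ isE i j = true) := by
      intro k h1 h2
      constructor
      · intro h
        by_contra hc
        have hc' : isE i j = false := by simpa using hc
        have := land_beq_zero hQ k h
        rw [h2 hc'] at this
        exact Bool.noConfusion this
      · intro h
        have := land_beq_left (a := fmask n F true prs) (b := t) (by rwa [Nat.land_comm]) k (h1 h)
        exact this
    by_cases hin : fidx F i = n
    · have hjn : fidx F j ≠ n := fun h => hne (hin.trans h.symm)
      simp only [g, hin, hjn, if_true, if_false]
      refine ⟨hv _ (by omega), ?_⟩
      rw [← tb _ hj hjn]
      exact hPQ _ (fun h => (fmask_true n F true prs _ _ (prs_mem i j hij) hne h).1 hin)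
        (fun h => (fmask_true n F false prs _ _ (prs_mem i j hij) hne h).1 hin)
    · by_cases hjn : fidx F j = n
      · simp only [g, hin, hjn, if_true, if_false]
        refine ⟨(hv _ (by omega)).symm, ?_⟩
        rw [G.adj_comm, ← tb _ hi hin]
        exact hPQ _ (fun h => (fmask_true n F true prs _ _ (prs_mem i j hij) hne h).2 hjn)
          (fun h => (fmask_true n F false prs _ _ (prs_mem i j hij) hne h).2 hjn)
      · simp only [g, hin, hjn, if_false]
        refine ⟨fun h => hne (hI.inj _ (by omega) _ (by omega) h), ?_⟩
        rw [hI.adj _ (by omega) _ (by omega)]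
        rcases hor with h | h | h
        · exact absurd h hin
        · exact absurd h hjn
        · rw [h]
  refine hG.fk (fun i => g (fidx F i)) ?_ ?_
  · intro i j hij
    by_contra hne
    rcases lt_or_gt_of_ne hne with h | h
    · exact (key i j h).1 hij
    · exact (key j i h).1 hij.symm
  · intro i j
    rcases lt_trichotomy i j with h | h | h
    · exact (key i j h).2
    · subst h; simp
    · rw [G.adj_comm, fork.adj_comm]; exact (key j i h).2

lemma filt1_sound {G : SimpleGraph V} (hG : Ctx G) {gs rows E : List ℕ} {f : ℕ → V}
    (hI : Inv G gs rows E f) (F : ℕ) : Inv G gs rows (filt1 rows F E) f := by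
  refine ⟨hI.inj, hI.adj, hI.lt, ?_, hI.good⟩
  intro v hv
  obtain ⟨t, ht, htr⟩ := hI.tr v hv
  refine ⟨t, ?_, htr⟩
  unfold filt1
  cases h : forkPre rows rows.length F
  · simpa using ht
  · rw [cond_true, List.mem_filter]
    refine ⟨ht, ?_⟩
    by_contra hc
    simp only [Bool.not_eq_true', Bool.not_eq_false, Bool.and_eq_true] at hc
    exact fork_kill hG hI F h v hv t htr hc.1 hc.2

lemma filtF_sound {G : SimpleGraph V} (hG : Ctx G) {gs rows : List ℕ} {f : ℕ → V}
    (fk : List ℕ) : ∀ E : List ℕ, Inv G gs rows E f → Inv G gs rows (filtF rows fk E) f := by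
  induction fk with
  | nil => intro E h; exact h
  | cons F fk ih => intro E h; exact ih _ (filt1_sound hG h F)

/-! ### Adding a vertex -/

lemma addGo_length (s n : ℕ) (rows : List ℕ) : ∀ i, (addGo s n i rows).length = rows.length + 1 := by
  induction rows with
  | nil => intro i; rfl
  | cons r rs ih => intro i; simp [addGo, ih]

lemma addGo_getD (s n : ℕ) (rows : List ℕ) : ∀ i k, k < rows.length →
    (addGo s n i rows).getD k 0 =
      bif s.testBit (i + k) then rows.getD k 0 ||| 2 ^ n else rows.getD k 0 := by
  induction rows with
  | nil => intro i k hk; simp at hk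
  | cons r rs ih =>
    intro i k hk
    cases k with
    | zero => simp [addGo]
    | succ k =>
      have := ih (i + 1) k (by simpa using hk)
      rw [addGo, List.getD_cons_succ, List.getD_cons_succ, this]
      congr 2
      omega

lemma addGo_getD_last (s n : ℕ) (rows : List ℕ) : ∀ i,
    (addGo s n i rows).getD rows.length 0 = s := by
  induction rows with
  | nil => intro i; rfl
  | cons r rs ih => intro i; rw [addGo, List.length_cons, List.getD_cons_succ, ih]

lemma addv_length (rows : List ℕ) (s : ℕ) : (addv rows s).length = rows.length + 1 :=
  addGo_length _ _ _ _

lemma adjK_addv_lt (rows : List ℕ) (s i j : ℕ) (hi : i < rows.length) :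
    adjK (addv rows s) i j = true ↔
      adjK rows i j = true ∨ (j = rows.length ∧ s.testBit i = true) := by
  unfold adjK addv
  rw [addGo_getD _ _ _ _ _ hi, Nat.zero_add]
  cases h : s.testBit i
  · simp
  · rw [cond_true, testBit_or_pow]; simp

lemma adjK_addv_last (rows : List ℕ) (s j : ℕ) :
    adjK (addv rows s) rows.length j = s.testBit j := by
  unfold adjK addv
  rw [addGo_getD_last]

lemma uncM_congr (G : SimpleGraph V) (f g : ℕ → V) (M n : ℕ)
    (hM : ∀ i, M.testBit i = true → i < n) (h : ∀ i < n, f i = g i) :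
    uncM G f M = uncM G g M := by
  ext v
  simp only [uncM, Set.mem_ofPred_eq]
  refine forall_congr' fun i => ?_
  by_cases hi : M.testBit i = true
  · rw [h i (hM i hi)]
  · simp [hi]

def updF (f : ℕ → V) (n : ℕ) (v : V) : ℕ → V := fun i => if i = n then v else f i

lemma child_sound {G : SimpleGraph V} (hG : Ctx G) {gs rows E : List ℕ} {f : ℕ → V}
    (hI : Inv G gs rows E f) (s : ℕ) (fk : List ℕ) (v : V)
    (hv : ∀ i < rows.length, v ≠ f i) (hs : Tr G rows.length f v s) :
    Inv G gs (addv rows s) (childE rows E s fk) (updF f rows.length v) := by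
  apply filtF_sound hG
  set n := rows.length with hn
  have hlen : (addv rows s).length = n + 1 := addv_length rows s
  have e1 : ∀ i < n, updF f n v i = f i := by
    intro i hi; simp [updF, hi.ne]
  have e2 : updF f n v n = v := by simp [updF]
  refine ⟨?_, ?_, ?_, ?_, ?_⟩
  · rw [hlen]
    intro i hi j hj hij
    rcases Nat.lt_succ_iff_lt_or_eq.1 hi with hi | hi <;>
      rcases Nat.lt_succ_iff_lt_or_eq.1 hj with hj | hj
    · rw [e1 i hi, e1 j hj] at hij
      exact hI.inj i hi j hj hij
    · subst hj; rw [e1 i hi, e2] at hij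
      exact absurd hij.symm (hv i hi)
    · subst hi; rw [e1 j hj, e2] at hij
      exact absurd hij (hv j hj)
    · omega
  · rw [hlen]
    intro i hi j hj
    rcases Nat.lt_succ_iff_lt_or_eq.1 hi with hi | hi <;>
      rcases Nat.lt_succ_iff_lt_or_eq.1 hj with hj | hj
    · rw [e1 i hi, e1 j hj, adjK_addv_lt _ _ _ _ hi, hI.adj i hi j hj]
      constructor
      · exact Or.inl
      · rintro (h | h)
        · exact h
        · omega
    · subst hj
      rw [e1 i hi, e2, adjK_addv_lt _ _ _ _ hi, G.adj_comm]
      constructor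
      · intro h; exact Or.inr ⟨rfl, (hs i).2 ⟨hi, h⟩⟩
      · rintro (h | h)
        · exact absurd (hI.lt _ _ h) (lt_irrefl _)
        · exact ((hs i).1 h.2).2
    · subst hi
      rw [e1 j hj, e2, adjK_addv_last, hs j]
      exact ⟨fun h => ⟨hj, h⟩, fun h => h.2⟩
    · subst hi; subst hj
      rw [adjK_addv_last, hs]
      simp
  · intro i j h
    rw [hlen]
    rcases lt_trichotomy i n with hi | hi | hi
    · rw [adjK_addv_lt _ _ _ _ hi] at h
      rcases h with h | h
      · have := hI.lt _ _ h; omega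
      · omega
    · rw [hi, adjK_addv_last] at h
      have := ((hs j).1 h).1; omega
    · unfold adjK at h
      rw [List.getD_eq_default _ _ (by omega)] at h
      simp at h
  · intro w hw
    rw [hlen] at hw ⊢
    have hw' : ∀ i < n, w ≠ f i := by
      intro i hi; rw [← e1 i hi]; exact hw i (by omega)
    have hwv : w ≠ v := by rw [← e2]; exact hw n (by omega)
    obtain ⟨t, ht, htr⟩ := hI.tr w hw'
    by_cases hadj : G.Adj w v
    · refine ⟨t ||| 2 ^ n, ?_, ?_⟩
      · unfold expand
        rw [List.mem_append, List.mem_map]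
        right
        refine ⟨t, List.mem_filter.2 ⟨ht, ?_⟩, rfl⟩
        by_contra hc
        obtain ⟨k, h1, h2⟩ := land_bne_zero (a := t) (b := s) (Bool.eq_false_iff.2 hc)
        exact hG.tri hadj ((hs k).1 h2).2 ((htr k).1 h1).2
      · intro j
        rw [testBit_or_pow, htr j]
        rcases lt_trichotomy j n with hj | hj | hj
        · rw [e1 j hj]
          constructor
          · rintro (h | h)
            · exact ⟨by omega, h.2⟩
            · omega
          · intro h; exact Or.inl ⟨hj, h.2⟩
        · subst hj
          rw [e2]
          exact ⟨fun _ => ⟨by omega, hadj⟩, fun _ => Or.inr rfl⟩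
        · constructor
          · rintro (h | h) <;> omega
          · intro h; omega
    · refine ⟨t, ?_, ?_⟩
      · unfold expand
        exact List.mem_append_left _ ht
      · intro j
        rw [htr j]
        rcases lt_trichotomy j n with hj | hj | hj
        · rw [e1 j hj]
          exact ⟨fun h => ⟨by omega, h.2⟩, fun h => ⟨hj, h.2⟩⟩
        · subst hj
          rw [e2]
          exact ⟨fun h => absurd h.1 (lt_irrefl _), fun h => absurd h.2 hadj⟩
        · constructor <;> intro h <;> omega
  · intro C hC
    obtain ⟨h1, h2⟩ := hI.good C hC
    refine ⟨fun i hi => ?_, ?_⟩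
    · rw [hlen]; have := h1 i hi; omega
    · rw [uncM_congr G (updF f n v) f C n h1 e1]
      exact h2

lemma xcl_sound {G : SimpleGraph V} {gs rows E : List ℕ} {f : ℕ → V}
    (hI : Inv G gs rows E f) (s : ℕ)
    (h : ∀ v, (∀ i < rows.length, v ≠ f i) → ¬ Tr G rows.length f v s) :
    Inv G gs rows (E.filter (fun t => !(Nat.beq t s))) f := by
  refine ⟨hI.inj, hI.adj, hI.lt, ?_, hI.good⟩
  intro v hv
  obtain ⟨t, ht, htr⟩ := hI.tr v hv
  refine ⟨t, List.mem_filter.2 ⟨ht, ?_⟩, htr⟩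
  by_contra hc
  have : t = s := by simpa [Nat.beq_eq] using hc
  exact h v hv (this ▸ htr)

theorem check_sound [Fintype V] {G : SimpleGraph V} (hG : Ctx G) {gs : List ℕ} (c : Cert) :
    ∀ {rows E : List ℕ} {f : ℕ → V}, Inv G gs rows E f → check gs c rows E = true → False := by
  induction c with
  | X xs ord => intro rows E f hI h; exact chkX_sound hG hI xs ord h
  | good C D => intro rows E f hI h; exact chkG_sound hI C D h
  | cut s fk sub next ih1 ih2 =>
    intro rows E f hI h
    simp only [check, Bool.and_eq_true] at h
    refine ih2 (xcl_sound hI s fun v hv hs => ?_) h.2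
    exact ih1 (child_sound hG hI s fk v hv hs) h.1

/-- Traces of unknown vertices on the root are independent sets. -/
lemma root_sound {G : SimpleGraph V} (hG : Ctx G) {gs rows : List ℕ} {f : ℕ → V}
    (inj : ∀ i < rows.length, ∀ j < rows.length, f i = f j → i = j)
    (adj : ∀ i < rows.length, ∀ j < rows.length, (G.Adj (f i) (f j) ↔ adjK rows i j = true))
    (lt : ∀ i j, adjK rows i j = true → j < rows.length)
    (good : ∀ C ∈ gs, (∀ i, C.testBit i = true → i < rows.length) ∧
      ∀ D : Fin 5 → V, IsC5 G D → (uncM G f C).ncard ≤ (unc G D).ncard) :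
    Inv G gs rows (rootE rows) f := by
  classical
  refine ⟨inj, adj, lt, ?_, good⟩
  intro v hv
  set n := rows.length with hn
  let t := Nat.ofBits (fun i : Fin n => decide (G.Adj v (f i)))
  have htr : Tr G n f v t := by
    intro j
    by_cases hj : j < n
    · rw [Nat.testBit_ofBits_lt _ _ hj]; simp [hj]
    · rw [Nat.testBit_ofBits_ge _ _ (by omega)]; simp [hj]
  refine ⟨t, List.mem_filter.2 ⟨List.mem_range.2 (Nat.ofBits_lt_two_pow _), ?_⟩, htr⟩
  rw [List.all_eq_true]
  intro i hi
  have hi' : i < n := List.mem_range.1 hi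
  by_contra hc
  simp only [Bool.or_eq_true, Bool.not_eq_true', not_or, Bool.not_eq_false] at hc
  obtain ⟨k, h1, h2⟩ := land_bne_zero (Bool.eq_false_iff.2 hc.2)
  have hk := (htr k).1 h1
  have hik := (adj i hi' k hk.1).2 h2
  exact hG.tri ((htr i).1 hc.1).2 hik hk.2

/-! ### Facts about a minimal counterexample -/

lemma ctx_of_minCex [Fintype V] {G : SimpleGraph V} (hG : MinCex G) : Ctx G := by
  classical
  obtain ⟨h3, hf, h4, hmin⟩ := hG
  refine ⟨?_, ?_, ?_, ?_⟩
  · intro a b c hab hbc hac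
    exact h3 {a, b, c} (SimpleGraph.is3Clique_triple_iff.2 ⟨hab, hac, hbc⟩)
  · intro F hF hadj
    exact hf.elim ⟨⟨F, hF⟩, fun {i j} => hadj i j⟩
  · intro S hS
    obtain ⟨s, hs⟩ := hS
    have hcard : Fintype.card {v : V // v ∉ S} < Fintype.card V :=
      Fintype.card_subtype_lt (x := s) (by simpa using hs)
    let ι : {v : V // v ∉ S} ↪ V := Function.Embedding.subtype _
    have hcf : (G.comap ι).CliqueFree 3 := by
      have e : G.comap ι ↪g G := SimpleGraph.Embedding.comap ι G
      exact SimpleGraph.CliqueFree.comap ⟨e.toCopy⟩ h3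
    have hff : ForkFree (G.comap ι) :=
      ⟨fun φ => hf.elim (φ.trans (SimpleGraph.Embedding.comap ι G))⟩
    have h := hmin _ (G.comap ι) hcard hcf hff
    have h' : (G.comap ι).Colorable 3 := by
      rw [← SimpleGraph.chromaticNumber_le_iff_colorable]; exact_mod_cast h
    obtain ⟨κ⟩ := h'
    refine ⟨fun v => if hv : v ∉ S then κ ⟨v, hv⟩ else 0, ?_⟩
    intro a b ha hb hab
    simp only [ha, hb, not_false_eq_true, dif_pos]
    exact κ.valid hab
  · intro κ
    by_contra hc
    push Not at hc
    have hcol : G.Colorable 3 := ⟨SimpleGraph.Coloring.mk κ fun {a b} hab => hc a b hab⟩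
    have := SimpleGraph.chromaticNumber_le_iff_colorable.2 hcol
    have h5 := h4.trans this
    exact absurd h5 (by decide)

lemma ctx_reachable {G : SimpleGraph V} (hG : Ctx G) (a b : V) : G.Reachable a b := by
  classical
  by_contra hab
  let K : Set V := {v | G.Reachable a v}
  obtain ⟨κ1, h1⟩ := hG.col K ⟨a, SimpleGraph.Reachable.refl a⟩
  obtain ⟨κ2, h2⟩ := hG.col Kᶜ ⟨b, hab⟩
  obtain ⟨x, y, hxy, he⟩ := hG.ncol (fun v => if v ∈ K then κ2 v else κ1 v)
  by_cases hx : x ∈ K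
  · have hy : y ∈ K := SimpleGraph.Reachable.trans hx hxy.reachable
    simp only [hx, hy, if_true] at he
    exact h2 x y (fun h => h hx) (fun h => h hy) hxy he
  · have hy : y ∉ K := fun hy => hx (SimpleGraph.Reachable.trans hy hxy.symm.reachable)
    simp only [hx, hy, if_false] at he
    exact h1 x y hx hy hxy he

lemma two_le_distC_iff {G : SimpleGraph V} (hG : Ctx G) (d : Fin 5 → V) (u : V) :
    2 ≤ distC G d u ↔ u ∈ unc G d := by
  unfold distC unc
  rw [Finset.le_inf'_iff]
  simp only [Finset.mem_univ, true_implies, Set.mem_ofPred_eq]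
  refine forall_congr' fun i => ?_
  have hr := ctx_reachable hG u (d i)
  constructor
  · intro h
    refine ⟨fun he => ?_, fun ha => ?_⟩
    · rw [he, SimpleGraph.dist_self] at h; omega
    · rw [SimpleGraph.dist_eq_one_iff_adj.2 ha] at h; omega
  · rintro ⟨h1, h2⟩
    have := hr.pos_dist_of_ne h1
    have h3 : G.dist u (d i) ≠ 1 := fun h => h2 (SimpleGraph.dist_eq_one_iff_adj.1 h)
    omega

lemma good_unc {G : SimpleGraph V} (hG : Ctx G) {c : Fin 5 → V} (hc : GoodC5 G c)
    (D : Fin 5 → V) (hD : IsC5 G D) : (unc G c).ncard ≤ (unc G D).ncard := by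
  have h := hc.2 D hD
  have e : ∀ d, {u : V | 2 ≤ distC G d u} = unc G d := fun d => by
    ext u; exact two_le_distC_iff hG d u
  rwa [e, e] at h

/-! ### Certificates -/

def fkA : List ℕ := [3040701080500,6070400080201,6050403080102,7060302080005,6050304080100,6070302080001,4030701080502,7060400080205]

def certR1 : Cert :=
 (.cut 176 [4080201090607,9060302080005,1070304090508,7080203090004,6090100080304]
 (.good 31 [2,3,4,8,5])
 (.cut 168 [9060400080205,3080001090607,1070403090508,7080004090203,6090102080403]
 (.good 31 [0,4,3,8,5])
 (.cut 148 [7080500090304,6050903080102,6070004090208,4080506090107]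
 (.good 31 [2,5,6,7,8])
 (.cut 84 [9030701080502,6080100090304,7060004090208,4080107090506,3090005080706]
 (.good 31 [1,2,8,6,7])
 (.cut 82 [4080205090706,9070302080001,5060304090108,6080203090004]
 (.good 31 [1,2,3,4,8])
 (.cut 74 [3080005090706,9070400080201,5060403090108,6080004090203,7090502080403]
 (.good 31 [0,1,8,3,4])
 (.cut 20 [9030701080502,6050903080102,9080701050302,6090100080304,7090500080304,9080605030102]
 (.X [(3,256)] [4,8,2])
 (.cut 9 [9040701080500,6090102080403,7090502080403,9080701050400,6050904080100,9080605040100]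
 (.X [(4,256)] [3,8,0])
 (.cut 160 [9060400080205,9080400060205,9060302080005,3090001080607,4090201080607,9080302060005]
 (.X [(8,64)] [6,7,5])
 (.cut 66 [9070400080201,9080400070201,3090005080706,4090205080706,9070302080001,9080302070001]
 (.X [(8,128)] [6,7,1])
 (.cut 137 [7080502090403,6050904080100,6070203090008,3080506090107]
 (.good 31 [0,5,6,7,8])
 (.cut 73 [6080102090403,9040701080500,7060203090008,3080107090506]
 (.good 31 [0,1,7,6,8])
 (.X [(0,0),(1,0),(2,0),(5,0)] [4,3,6,7])))))))))))))

def fkB : List ℕ := [3040701080500,6050403080102,6080400070201,7080400060205,6050701080400,6050304080100,4030701080502,6050701080302,6080302070001,7080302060005]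

def fkR2a : List ℕ := [9080400060205,9060400080205,9080302060005,9060302080005,8050304090100,1070403080609,1070304080609,3090100080605,4090102080605,8050701090400,8050701090302,8050403090102]

def fkR2b : List ℕ := [10090400070201,10070400090201,6050901100400,6050901100302,3040901100500,10090302070001,3100500090701,4100502090701,10070302090001,8050901100400,8050901100302,4030901100502,5060403090710,5060304090710,1090403080610,1090304080610,5080403090710,5080304090710]

def certR2 : Cert :=
 (.X [(6,256)] [8,5])

def fkR2c : List ℕ := [9080400070201,9070400080201,9080302070001,9070302080001,3040801090500,5060403080709,5060304080709,3090500080701,4090502080701,6050801090400,6050801090302,4030801090502]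

def certR2c : Cert :=
 (.cut 448 [9070400100201,9060302100005,9060400100205,3100506080709,4100506080709]
 (.cut 340 [7090005111006,6100100110304,11030701100502,5060304110810,7110005100302,11080004060210,7090005100311,10080500070311,10080500110701,3111008070001,9060102110410]
  (.good 31 [0,4,10,6,5])
  (.cut 329 [7090205111006,6100102110403,5060403110810,11040701100500,7110205100400,11080203060010,7090205100411,10080502070411,10080502110701,4111008070201,9060100110310]
  (.good 31 [2,3,10,6,5])
  (.X [(8,128)] [7,9,1])))
 (.cut 340 [10030701090502,6090100100304,8090500100304,10080004060209,5060304100809,9080500100701,3100908070001,10060004080209,7100005090302,9080500070310,1080506100409]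
 (.X [(7,1)] [1,0])
 (.cut 329 [6090102100403,8090502100403,10040701090500,10080203060009,5060403100809,9080502100701,4100908070201,10060203080009,7100205090400,9080502070410,1080506100309]
 (.X [(7,4)] [2,1])
 (.X [(8,128)] [7,1]))))

def fkS0 : List ℕ := [6080100090304,7080500090304,9060004070208,9070004060208,1070506090408]

def certS0 : Cert :=
 (.cut 40 [9050804100100,3090806100005,10060400090205,9030001100802,8060100100905,9030100100804,10090400060205]
 (.X [(6,640)] [7,8,5,9,2,3,4,0,1])
 (.cut 196 [51003090802,10090408050102]
 (.good 31 [0,1,2,8,4])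
 (.cut 212 [51003090802,1070506100409]
 (.good 31 [0,1,2,8,4])
 (.cut 137 [7090502100403,6100201090400,9071004060208,6100102090403,10090804050100]
 (.good 31 [0,1,2,8,4])
 (.cut 73 [6090102100403,7100205090400,8041001090500,9061004070208,7100502090403,10090701050400]
 (.good 31 [0,1,2,8,4])
 (.cut 208 [10030500090804,9070302100001,1070506100409]
 (.good 31 [0,1,2,8,4])
 (.cut 34 [3100807090001,10070400090201,10090400070201]
 (.X [(9,192)] [7,1,6,5,2,8])
 (.cut 290 [10070400090201,10090400070201]
 (.X [(9,192)] [5,6,8,7,1,2])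
 (.cut 197 [10090804050100,8041001090500]
 (.good 31 [0,4,3,2,9])
 (.cut 296 [10060102090408,10090400060205]
 (.X [(6,512)] [8,9,5])
 (.X [(5,2),(6,128)] [1,7,2,8,0])))))))))))

def fkS1 : List ℕ := [7080203090004,6090100080304,8070302090001,6050804090100,8070302060009,8090302060005,7080203060009]

def certS1 : Cert :=
 (.cut 136 [7090004100203,4080201100907,3090001100807,8040102100903]
 (.X [(4,0),(7,0),(3,0),(5,0),(2,0),(0,0),(1,0)] [6,8,9])
 (.cut 200 [7090004100203,3090001100807,8040102100903,5060403100709,4080201100907]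
 (.good 31 [1,2,3,9,7])
 (.cut 128 [9070400100201,9100400060205,4080201100907,6100001090807,9100804050100]
 (.cut 584 [6100004110203,8040102111003,10030100110804,5060403110910,9100102110403,6100004070211]
  (.X [(0,0),(1,0),(2,0),(5,0)] [4,3,6,7])
  (.cut 840 [6100004110203,9100102110403,6100004110708,11060203090810,11090203080610,5060403110910,6100004070211]
  (.good 31 [0,1,7,8,4])
  (.cut 40 [11060400100205,8040102111003,11100400060205,9110004100203,10030100110804,10110001090807,8110100100605]
  (.X [(6,1024)] [10,5])
  (.cut 296 [5100107110408,7080005110310,11060400100205,9110004100203,10080001110907,6110102100403,9070004111008,9070004100211]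
  (.X [(6,0)] [5])
  (.cut 148 [9070502110410,6051103100102,11080100100304,11030500100804,11090001100807,11100605030102,6110004070210,11080001100907]
  (.good 31 [0,1,7,10,4])
  (.cut 522 [8040502111003,11100400070201,9100502110403,10030500110804]
  (.good 31 [0,1,7,8,4])
  (.cut 778 [9100502110403,11080001090310,11090001080310,11100400070201,6110004100708]
  (.good 31 [0,1,10,3,4])
  (.cut 73 [8040102111003,11100701050400,6100102110403,10110201090807]
  (.good 31 [0,1,7,8,4])
  (.X [(0,0),(1,0),(2,0),(5,0)] [4,3,6,7])))))))))
 (.cut 192 [9070400100201,9060400100205,6090001100807,4080201100907,6090001080310]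
 (.cut 320 [7090205111006,6100004110708,10060400110205,10110400070201,8100005110906,7090403100511]
  (.X [(7,0),(2,0),(8,0),(4,0),(0,0),(5,0),(6,0)] [1,10,3,9])
  (.cut 264 [9110004100203,6110102100403,9070004111008,10080001110907]
  (.X [(2,1216),(5,0),(0,0),(1,0)] [3,4,10,6,7])
  (.cut 328 [6100004110203,7090205111006,6100004110708,7080203110610,3100005110906]
  (.good 31 [0,1,7,8,4])
  (.cut 552 [8040102111003,7090403110510,3100107110609,11060400100205,10090001110807,8110100100605]
  (.X [(6,1024)] [9,10,5])
  (.cut 522 [8040502111003,11100400070201,3100506110709]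
  (.good 31 [0,1,7,8,4])
  (.cut 554 [9100804110203,11100400070201,11090403050110,11060400100205]
  (.X [(6,132)] [5,2,7,9,10,1])
  (.cut 73 [8040102111003,11100701050400,6100102110403,7090205111006]
  (.good 31 [0,1,7,8,4])
  (.cut 256 [1070304111008,10080001110907,5110107100408,10110403050102]
  (.X [(5,0),(2,0),(4,0),(7,0),(1,0),(0,0)] [6,9,3,8])
  (.cut 768 [1070506111009,3110107100609,10110403050102]
  (.X [(1,0),(8,0),(5,0),(4,0),(0,0)] [2,3,6,10,7,9])
  (.X [(1,0),(7,68),(4,0),(8,520)] [9,6,3,2,0,5]))))))))))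
 (.cut 328 [6090004100203,6090004100708,7080203100609,6090004070210]
 (.cut 64 [8090205111006,10110100080304,3090005111006,10060203110809]
  (.X [(7,16),(1,0),(0,0)] [4,8,5,2])
  (.cut 320 [10080100110304,7110309100506,3090005111006,11100004090708,10110903050102]
  (.X [(6,8),(2,0),(5,0),(10,144)] [1,7,0,8,4,3,9])
  (.cut 144 [10040102110903,9080001111007,9080201111007,11100100080304,7100203060011]
  (.X [(6,1032),(2,0),(5,0)] [3,9,0,1,10])
  (.cut 72 [8090205111006,10030100110804,8090005111006,11100102090403,6100004070211]
  (.X [(10,512)] [6,9,3])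
  (.cut 328 [7110205100906,41102100903,11100102090403,6100004070211]
  (.X [(10,512)] [6,9,3,8])
  (.cut 196 [9030001111002,6100001110807,11100403050102]
  (.X [(0,64),(1,0),(4,0)] [3,2,5,6,7,8,9,10])
  (.X [(6,1),(9,144)] [3,4,8,7,0,5])))))))
 (.cut 40 [8040102100903,10060400090205,9030100100804,10090400060205,9050804100100,8100100090605,3090807060010]
 (.cut 10 [11100400070201,11090004100203,10030500110804,8070500111001,41102100903,1100509110403]
  (.X [(6,4)] [5,2])
  (.cut 196 [41002110903,9110001100807,11100403050102,9030001100811,9030001111002]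
  (.X [(0,0),(1,1064),(7,0)] [3,4,2,10,5,8])
  (.X [(6,512)] [9,5])))
 (.cut 296 [10060400090205,5090107100408,7080005100309,6100102090403,8091002060005]
 (.cut 193 [3110807060010,9051101100400,2031000110804,8040201111000,8091000110205,10060102110905,11100304050100,10110102090403]
  (.X [(6,132)] [5,2,7,10,0,1])
  (.cut 705 [3110807060010,10090102110403,2031000110804,8041101100500,8040201111000,11100304050100]
  (.X [(6,132)] [5,2,7,10,0,1])
  (.X [(6,4)] [5,2])))
 (.cut 148 [10030500090804,6100004070209,10080100090304,10090605030102,6051003090102,6100001090302,8100902060005]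
 (.cut 266 [9041001110500,10030500110904,11100400070201,8100902110001,9070500111001,7091003060011,3100907060011]
  (.X [(7,1040)] [4,9,8,10,1,3,2])
  (.X [(8,512)] [7,9,4]))
 (.cut 10 [8040502100903,10090400070201,8040901100500,9030500100804,3090807060010]
 (.cut 196 [41002110903,11100403050102,6100001080311,50903111002,6100001110807]
  (.X [(9,4)] [2,3,1])
  (.cut 708 [11100403050102,6100001080311,8071106090210,6100001110807]
  (.X [(9,4)] [2,10,1,3])
  (.cut 266 [11100400070201,6110004100708,8101109020001]
  (.X [(7,1024)] [8,10,1])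
  (.cut 42 [11100400070201,11060400100205]
  (.X [(2,1024)] [3,10,1,5])
  (.cut 298 [11060400100205,11100400070201,11080605030110,8101109020001]
  (.X [(2,1024)] [3,10,1,5])
  (.X [(9,16),(7,16),(0,0),(1,0)] [2,3,4,5,8]))))))
 (.cut 266 [10090400070201,6100004090203,6100004090708,6100001080309]
 (.cut 196 [41002110903,6100001110807,11100403050102,6100001080311,50903111002,10070004110908]
  (.X [(7,65),(8,1032),(4,0)] [9,3,1,0,10,6,2,5])
  (.cut 298 [11100400070201,6051103080110,11060400100205,5101107090408,11080605030110]
  (.X [(2,1024)] [3,10,1,5])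
  (.cut 193 [11100901050400,8040201111000,2031000110804,8091000110201,10070502110901,10110502090403,3110807060010]
  (.X [(4,0),(10,0),(9,0),(7,0),(5,0),(2,0),(1,0),(0,0)] [8,6,3])
  (.cut 256 [11100004090708,10080100110304,1070304111008,6111008030109,10110502090403,10110304050100]
  (.X [(10,16)] [8,4])
  (.cut 144 [10040502110903,11100100080304,9030500111004,2031100100804,10110809020001,7100203060011]
  (.X [(7,528),(10,8)] [3,4,8,9,1])
  (.X [(7,512)] [8,9,1]))))))
 (.cut 42 [10090400070201,10060400090205,6100804090203,3090807060010]
 (.X [(6,128),(5,10)] [2,3,1,9,0,7])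
 (.cut 298 [10060400090205,10090400070201,6051003080109,10080605030109,6100001080309]
 (.cut 144 [2031100100804,10071100090201,6110001100807,11100100080304,7100203060011]
  (.X [(2,512)] [3,9,1,5])
  (.cut 656 [2031100100804,6110001100807,6051103100109,11100100080304,7100203060011]
  (.X [(2,512)] [3,9,1,5])
  (.cut 193 [8040201111000,5091007110408,11100304050100]
  (.X [(6,132)] [5,2,7,10,0,1])
  (.cut 705 [8040201111000,11100304050100]
  (.X [(1,296)] [2,3,5,9,0,8,7,10,4])
  (.X [(8,8),(7,68)] [1,9,3,2,4,6])))))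
 (.cut 193 [8040201100900,10090304050100,2030900100804,10090804050100]
 (.cut 776 [9100102110403,11060400100709,90203110810,1070506111009]
  (.X [(6,132)] [5,2,7,9,0,1])
  (.cut 196 [11100403050102,11100408090107]
  (.X [(9,0),(1,0),(4,0),(0,0),(5,0)] [2,3,7,8,6,10])
  (.X [(5,0),(9,0),(4,0),(7,0),(2,0),(0,0),(1,0)] [3,6,8])))
 (.cut 73 [8040102100903,10090701050400,6090102100403,7100203060009]
 (.cut 64 [7110309100506,8110205100906,10110100080304]
  (.X [(9,0),(0,0),(1,0),(3,0),(5,0),(2,0)] [6,4,7])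
  (.cut 320 [1070304111008,10080100110304,8100309110506]
  (.good 31 [0,1,7,8,4])
  (.X [(6,132),(3,0),(9,0)] [2,5,0,4,7])))
 (.cut 256 [1070304100908,9080100100304,9100403050102]
 (.cut 196 [11100403050102,9080001111007,10070004110908,6100001110807]
  (.X [(4,0),(2,0),(5,0),(7,0),(0,0),(1,0)] [3,6,10,8])
  (.X [(7,528),(0,0),(1,0)] [8,9,4,5,2]))
 (.cut 144 [10030100090804,10090100080304,6100001090807,10080100090304]
 (.X [(7,16),(0,0),(1,0)] [8,4,9,5,2])
 (.cut 320 [6090004100708,1070304100908]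
 (.cut 196 [8090005111006,11100403050102]
  (.X [(2,0),(6,0),(5,0),(4,0),(0,0),(1,0),(8,0),(7,0)] [9,10,3])
  (.X [(7,0)] [8,1]))
 (.X [(8,8),(7,68)] [2,1,3,4,6]))))))))))))))))))

def fkS2 : List ℕ := [7080500090304,6050903080102,6090001080302,6090100080304,9080605030102,6090004070208]

def certS2 : Cert :=
 (.cut 200 [6090004100203,9060802100005,3090001100807,7090502100403,9070400100201,5060403100709]
 (.good 31 [1,2,3,9,7])
 (.cut 40 [9050804100100,9030100100804,10060400090205,10090400060205,3090807060010,7080903100004,9050701100400,8100309060005,8100100090605]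
 (.X [(6,512)] [9,5])
 (.cut 193 [9070502100408,3100807060009,8041001090500,7090205100400,6090408100107,10090304050100]
 (.good 31 [0,4,8,2,5])
 (.cut 128 [9070400100201,9100400060205,6100408090107,9070502100408,9100302060005,7090203060010,9070302100001,9070004100208]
 (.good 31 [0,1,7,8,4])
 (.cut 192 [9070400100201,9060302100005,9070502100408,6090001080310,9060400100205,6090001100807,9100100080304]
 (.good 31 [0,1,7,8,4])
 (.X [(7,4)] [2,8,1]))))))

def fkS3 : List ℕ := [9060400080205,9080400070201,9070302080001,9080302060005]

def certS3 : Cert :=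
 (.cut 196 [9020400100801,4030801100902,9020400100805,10090403050102]
 (.X [(8,192)] [7,1,6,5,2,9])
 (.cut 193 [3020900100801,3040801100900,3020900100805,10090304050100]
 (.X [(6,384)] [7,9,5,8,0,1])
 (.cut 197 [3040801100900,10090304050100]
 (.X [(6,384)] [7,9,5,8,0,1])
 (.X [(6,256)] [8,5]))))

def fkS4 : List ℕ := [9060400070208,9070400060208,9080304050100]

def certS4 : Cert :=
 (.good 31 [0,4,3,2,8])

def fkS5 : List ℕ := [6080203090004,1070506090408]

def certS5 : Cert :=
 (.cut 64 [9060400100205,4080205100906,9100400070201,9060004100708,7080005090310]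
 (.cut 8 [8040102111003,10110005090806,8040502111003,10030100110804]
  (.good 31 [0,4,8,6,5])
  (.cut 520 [8040502111003,10090005110806,8040102111003,1070506100411]
  (.good 31 [0,4,8,6,5])
  (.cut 552 [7110005090310,9100004110203,10030100110804,8040102111003,11100400060205]
  (.good 31 [0,4,8,6,5])
  (.good 31 [0,1,7,8,4]))))
 (.cut 192 [9070400100201,4080201100907,9060400100205]
 (.cut 8 [9110004100203,10110005090806,8040102111003,10030100110804]
  (.good 31 [0,1,7,8,4])
  (.cut 520 [10090005110806,1070506111009,8040102111003,8040502111003,10090408050111,1070506100411]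
  (.good 31 [0,1,7,8,4])
  (.cut 552 [10090001110807,3100107110609,8040102111003,11100400060205]
  (.good 31 [0,1,7,8,4])
  (.good 31 [0,1,7,8,4]))))
 (.cut 208 [10030100090804,1070506100409,10030500090804,2031000090804]
 (.cut 552 [10090001110807,8110910020005,11100400060205,8040102111003]
  (.good 31 [0,1,7,9,4])
  (.good 31 [0,1,7,8,4]))
 (.cut 8 [8040102100903,8040502100903,9100804050100]
 (.cut 296 [11100400060205,11070004100608,41102100903,1110510090403,11090102100403,11100102090403,50903110810]
  (.X [(9,4)] [3,2])
  (.X [(6,128),(5,10)] [0,1,7,2,8,3]))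
 (.cut 40 [8040102100903,10090400060205,9050804100100]
 (.cut 705 [10090804110203,4080201111007,9100408110107,10090102110403,11100304050100]
  (.good 31 [0,4,3,9,10])
  (.X [(9,4)] [3,2,5]))
 (.good 31 [0,1,7,8,4]))))))

def fkS6 : List ℕ := [9060302080005,9080302070001,9070302080001,9080302060005,6050701090408]

def certS6 : Cert :=
 (.cut 448 [9080203100004,9070400100201,9060400100205,10090304050108]
 (.cut 552 [10090201110408,3100107110609,9100102110403,4081106100205,3101106080005,11100400060205]
  (.good 31 [3,4,8,5,10])
  (.cut 522 [10090205110408,3100506110709,9100502110403,4081107100201,3101107080001,11100400070201]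
  (.good 31 [1,8,4,3,10])
  (.cut 554 [9100004110203,4081107100201,3101107080001,11070400100201,11100400070201]
  (.good 31 [1,8,4,3,10])
  (.cut 520 [10090201110408,1070506111009,9100102110403,3100506110709,3100107110609,11100408070609]
  (.X [(6,128),(5,530)] [7,9,1,8,4,0,2])
  (.cut 193 [2031000110804,11100304050100]
  (.X [(9,1040)] [6,10,7,4,8,0,5,1])
  (.X [(0,256)] [4,8,1,5]))))))
 (.cut 48 [3100100090605,2031000090804,10090203080004]
 (.cut 520 [7110205100409,10090100110605,10091102080005,1110605100409,6050701100411]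
  (.X [(0,256)] [4,8,1,5])
  (.cut 196 [3111007080001,9110001100302,11100905030102,9051103100102,9051101100302,10060100110905,10110100090304,6100001090311]
  (.X [(9,1)] [4,0,5])
  (.cut 449 [2031000110904,4091006110205,9040201111000,11100304050100]
  (.X [(0,704)] [4,9,5,6,10,7,1,8])
  (.cut 452 [10081103090004,9110001100302,11100905030102,9051101100302,10060100110905,10110100090304,6100001090311]
  (.X [(0,704)] [4,9,5,6,1,7,8,10])
  (.X [(6,512)] [9,5])))))
 (.cut 40 [4081006090205,3091006080005,10090400060205]
 (.cut 964 [7100005110309,3090107110610]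
  (.good 31 [3,4,8,10,9])
  (.cut 530 [7110805100309,5090701110410,3110500100701,1100605110309,6110201090410]
  (.X [(0,256)] [4,8,1,5])
  (.cut 449 [9110201100400,11100905040100,9051101100400,9051104100100,10060102110905,4111006090205,10110102090403]
  (.X [(0,256)] [4,8,5,1,10])
  (.cut 961 [10090102110403,3090100110610]
  (.good 31 [3,4,8,10,9])
  (.cut 18 [3110500100701,11080903100004,3021100100801,11100302070001]
  (.X [(8,1220)] [2,1,10,4,5,6,7,0])
  (.cut 10 [1100509110403,41102100903,4081107100201,3101107080001,11100400070201]
  (.X [(7,1024)] [10,1])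
  (.X [(1,32),(7,64)] [2,5,6,0,8])))))))
 (.X [(5,2),(6,128)] [1,7,2,0,8]))))

def fkS7 : List ℕ := [8070400090201,8070302090001,8060400090205,8060302090005]

def certS7 : Cert :=
 (.cut 192 [9070400100201,9070302100001,9060400100205,9060302100005]
 (.cut 784 [1070506111008,1070506111009,8100100110304,4100506110708,4100107110608,2110004090810]
  (.X [(8,512)] [7,9,6,10])
  (.cut 816 [4100107110608,7080205110410,8100100110304,11060302100005,4100107110609,9100100110304,11100302060005,2110004090810]
  (.X [(8,512)] [7,9,6,10])
  (.cut 776 [1070506111008,1070506111009,8100102110403,3100506110708,110203090810]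
  (.X [(8,512)] [7,9,6,10])
  (.cut 808 [3100107110608,7080005110310,8100102110403,11060400100205,3100107110609,9100102110403,11100400060205,110203090810]
  (.X [(8,512)] [7,9,6,10])
  (.cut 786 [4100506110708,6080201110410,8100500110304,11070302100001,4100506110709,9100500110304,11100302070001,2110004090810]
  (.X [(8,512)] [7,9,6,10])
  (.cut 778 [3100506110708,6080001110310,8100502110403,11070400100201,3100506110709,9100502110403,11100400070201,110203090810]
  (.X [(8,512)] [7,9,6,10])
  (.cut 768 [1070506111008,1070506111009,10110304050100,10110403050102]
  (.X [(8,512)] [7,9,6,10])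
  (.cut 196 [11080005100906,11090005100806,11100403050102,11100005090806,110210090806]
  (.X [(8,1024)] [7,10,6])
  (.cut 193 [11080205100906,11090205100806,11100304050100,11100205090806]
  (.X [(8,1024)] [7,10,6])
  (.X [(0,0),(1,0),(2,0),(5,0)] [4,3,6,7]))))))))))
 (.cut 128 [6080001100907,9070400100201,9070302100001,6080001090310,6080201090410,9100400060205,9100302060005]
 (.cut 576 [7080005111006,9100005110806,9100205110806,10060400110205,10060302110005,7080403100511,7080304100511]
  (.X [(7,0),(6,0),(1,0),(2,0),(5,0),(0,0)] [3,4,9,10,8])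
  (.cut 304 [4100107110608,7080205110410,8100100110304,11060302100005,10080201110907,10080001110907,9110100100304,9070302100611]
  (.X [(6,1024)] [8,10,5])
  (.cut 296 [7080005110310,3100107110608,8100102110403,11060400100205,10080201110907,10080001110907,9110102100403,9070400100611]
  (.X [(6,1024)] [8,10,5])
  (.cut 512 [10090201110807,10090001110807,10110304050100,10110403050102]
  (.X [(7,0),(1,0),(2,0),(0,0),(5,0)] [3,4,8,6,9])
  (.cut 64 [7080005111006]
  (.cut 528 [9110100120304,8120100110304,11090201120807,11090001120807,10120100110304,11090203100812,11120205100806,11120005100806,7080203111012]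
   (.X [(7,0),(6,0),(5,0),(0,0),(1,0),(2,0)] [8,3,4,9,10])
   (.cut 1552 [9110100120304,7090004121011,8120100110304,11100205120806,11100005120806,2120004100911]
   (.X [(0,2240),(1,0),(2,0),(5,0)] [4,3,11,6,7])
   (.cut 520 [9110102120403,8120102110403,11090201120807,11090001120807,10120102110403,11090004100812,11120205100806,11120005100806,7080004111012]
   (.X [(7,0),(6,0),(5,0),(0,0),(1,0),(2,0)] [8,3,4,9,10])
   (.cut 1544 [9110102120403,7090203121011,8120102110403,11100205120806,11100005120806,120203100911]
   (.X [(2,2240),(1,0),(0,0),(5,0)] [4,3,11,6,7])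
   (.X [(9,256)] [8,7])))))
  (.X [(6,128),(5,0)] [7,8,2,0,1]))))))
 (.cut 64 [7080005100906,9060400100205,9060302100005,9100400070201,9100302070001,7080403090510,7080304090510]
 (.cut 274 [4100506110708,6080201110410,8100500110304,10080205110906,10080005110906,9110500100304,9060302100711]
  (.X [(7,1024)] [8,10,1])
  (.cut 266 [3100506110708,6080001110310,8100502110403,10080205110906,10080005110906,9110502100403,9060400100711]
  (.X [(7,1024)] [8,10,1])
  (.X [(7,64),(1,0)] [6,8,2,0,5])))
 (.cut 272 [1070506100908,8090100100304,4090506100708,4090107100608]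
 (.cut 304 [7080205110410,11090100100304,11030100100904,2031100100904,1110510090304,11090107100608,11100100090304]
  (.X [(3,0)] [4,2])
  (.X [(6,128),(5,0)] [7,8,2,0,1]))
 (.cut 304 [4090107100608,7080205100409,8090100100304]
 (.cut 304 [11100100090304,11030100100904,2031100100904,11060100100905,11090100100304,11100100090605]
  (.cut 266 [11080205120409,3110500120701,11080205120410,12110400070201]
   (.good 31 [3,4,9,8,11])
   (.X [(3,0)] [4,2]))
  (.cut 8 [4090107100611,9040102111003,9051003110102,8110502100403,6080201100411]
  (.cut 708 [12110403050102,10031201110502,10030001121102,9110001120302]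
   (.X [(8,2048)] [7,11,6,9])
   (.cut 274 [2031200110904,12110302070001,3100506110712,10030500121104,9051101120302]
   (.X [(6,129)] [7,8,5,0,9,4,1,11])
   (.X [(7,64),(1,0)] [6,8,2,0,5])))
  (.cut 196 [9080001111007,9051101100302,9110001100302,11100403050102,9080001100311]
  (.cut 1298 [2031200110904,3120500110701,12110302070001]
   (.X [(3,0)] [4,2])
   (.X [(0,192),(4,0),(9,192)] [8,6,7,5,1,3,2,10]))
  (.cut 708 [11100403050102]
  (.cut 708 [12080005111006,12110005100302,12100005110302]
   (.X [(10,258)] [2,1,7,8,6,9,11])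
   (.X [(6,129)] [7,8,10,5,0,9,1,2]))
  (.cut 274 [2031100100904,3110500100701,11100302070001]
  (.X [(3,0)] [4,2])
  (.X [(2,0),(3,258),(4,0),(9,193)] [1,0,5,6,7,8]))))))
 (.cut 296 [7080005100309,8090102100403,3090107100608]
 (.cut 196 [41002110903,9030001111002,11100403050102]
  (.cut 708 [12110005100302,12080005110309,12100001110302,12110005080309]
   (.X [(11,1280)] [6,10,7,8,2,9,5])
   (.cut 274 [8110500120304,4110506120708,9080201120411,10070500121101,10120500110304,11080005100312,3091006110012]
   (.X [(0,192),(4,0),(11,0)] [1,7,8,6,5,3,2,10])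
   (.cut 1298 [8110500120304,4110506120708,9080201120411]
   (.X [(7,65)] [6,8,10,1,0,11,2,5])
   (.X [(8,1032),(7,65)] [1,0,9,3,10,6,2,5]))))
  (.good 31 [0,4,3,9,5]))
 (.X [(6,128),(5,0)] [7,8,2,0,1])))))))

def certA : Cert :=
 (.cut 48 [9080302060005,3090100080605,9060302080005]
 (.cut 320 [9080203100004,7100304090508,9100400070201,9100302070001]
  (.good 31 [2,3,4,8,5])
  (.X [(6,4)] [5,2]))
 (.cut 18 [9080302070001,3090500080701,9070302080001]
 (.cut 384 [9080500100304,6100304090108,9100400060205]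
  (.good 31 [1,2,3,4,8])
  (.X [(7,4)] [2,1]))
 (.cut 8 []
 (.cut 196 [40902100803,10090403050102,8030001100902,10090803050102]
  (.X [(5,520),(0,0),(1,520)] [2,9,6,3,7,4])
  (.cut 40 [10090400060205,10080102090403,1100509080403,10040102090803,10060400090205,10090102080403]
  (.cut 452 [1070506110810,41002110903,9030001111002]
   (.X [(6,768)] [8,10,5,9,2,3])
   (.X [(6,512)] [9,5]))
  (.cut 452 [1070506100809]
  (.cut 10 [11100400070201,11080502100403,40902111003,11040502100803,11070400100201,51003110902,11100502080403]
   (.X [(7,1280)] [8,9,1,10,3,2])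
   (.X [(1,520),(0,0),(5,0)] [7,9,2,6,3,4]))
  (.cut 10 [10090400070201,10080502090403,10040502090803,10070400090201,10090502080403]
  (.X [(7,512)] [9,1])
  (.X [(0,0),(1,0),(2,0),(5,0)] [4,3,6,7])))))
 (.cut 128 [8070400090201,8090400060205]
 (.cut 128 [6100001090807,9070400100201,9100400060205]
  (.cut 40 [11100400060205,11060400100205,8110004100203]
   (.X [(6,1024)] [10,5])
   (.cut 778 [11080001090310,11090001080310,11100400070201,11070400100201,4110201090810]
   (.X [(7,1024)] [8,10,1,9])
   (.X [(3,0)] [4,2])))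
  (.cut 196 [10090403050102,8070302100609,6090001080310]
  (.cut 784 [2090004110810,9100100110304,11060302100709,10090001110302,4100102110609,1070506111009]
   (.X [(6,4)] [5,2,9])
   (.cut 40 [40902111003,11060400100205,11100400060205,10030001110902,10110001090807]
   (.X [(9,40),(7,0),(1,0)] [5,6,2,0,3,8])
   (.cut 266 [11100400070201,51003110902,9020400111001,8100004110203,6110001080310]
   (.X [(3,0),(1,0),(5,0),(0,0),(2,0),(9,0),(7,0)] [6,8,10,4])
   (.X [(5,520),(0,0),(1,0)] [2,9,6,3,7,4]))))
  (.X [(7,0)] [8,1])))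
 (.X [(7,4)] [2,1])))))

def certB : Cert :=
 (.cut 128 []
 (.cut 320 []
  (.cut 196 [9060302110710,8090005111006,6100001110807,8070302110610,7100005110906]
   (.cut 193 [9060400120711,8070400120611,8090205121106,12100809110506,12110809100506]
    (.X [(2,0),(0,0),(5,0),(1,0)] [6,11,10,7,3,4])
    (.X [(2,0),(7,0),(1,0),(0,0),(6,0),(5,0)] [9,8,3,4,10]))
   (.cut 193 [9060400110710,8090205111006,6100201110807,8070400110610,7100205110906]
   (.X [(6,0),(0,0),(7,0),(1,0),(2,0),(5,0)] [9,8,3,4,10])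
   (.X [(0,0),(1,0),(2,0),(5,0)] [4,3,6,7])))
  (.cut 272 [8090100100304]
  (.cut 708 [1070506110910,2100004110809,9101103050102,11060302090710,6100001110807,9100001110302,10090100110304]
   (.X [(3,0)] [4,2])
   (.cut 193 [11100904050100,9080201111007,8070400110610,6100201110807,2031000110904]
   (.cut 705 [1070506120911,12080201111007,9110205121006,6110304120809,9111210050100]
    (.X [(8,0)] [9,7])
    (.cut 196 [12110403050102,9080001121107,12110908100107,11120100090304]
    (.X [(2,0),(0,0),(5,0),(1,0)] [6,11,10,7,3,4])
    (.X [(7,0),(0,0),(5,0),(2,0),(1,0)] [6,10,4,3,8])))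
   (.cut 196 [11100403050102,9080001111007,6100001110807,10110100090304]
   (.X [(2,0),(1,0),(0,704),(5,0)] [10,7,6,4,9,3])
   (.X [(0,704),(1,0),(2,0),(5,0)] [4,3,9,6,7]))))
  (.cut 8 [8100102090403,8070400090610]
  (.cut 193 [11100304050100,6100201110807,8070400110610,9110807060010]
   (.cut 193 [12110201100400,12040201111000,12080201111007,12110201100807,9120205111006,12100201110807]
    (.X [(8,0)] [7])
    (.cut 196 [8070302120611,12110403050102,41102120903,9030001121102,9120001110807]
    (.X [(2,0),(0,0),(5,0),(1,0)] [6,11,10,7,3,4])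
    (.X [(0,0),(1,0),(2,704),(5,0)] [4,3,9,10,6,7])))
   (.cut 256 [10110403050102,10110102090403]
   (.cut 196 [8070302120611,10080001121107,6110001120807,12110403050102,41102120903]
    (.X [(2,0),(7,0),(1,0),(5,0),(0,0)] [4,3,6,11,8])
    (.X [(2,704),(5,0),(0,0),(1,0)] [3,4,9,6,7]))
   (.cut 768 [10090102110403,10110403050102]
   (.cut 196 [8070302120611,10080001121107,6110001120807,41102120903,12110403050102]
    (.X [(2,0),(7,0),(1,0),(5,0),(0,0)] [4,3,6,11,8])
    (.X [(2,704),(5,0),(0,0),(1,0)] [3,4,9,6,7]))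
   (.X [(8,0)] [7]))))
  (.cut 264 []
  (.cut 705 [100203110809,1070506110910,9101104050100,11060400090710,6100201110807,9100201110400,10090102110403]
   (.X [(4,0)] [3,0])
   (.cut 196 [8070302110610,9080001111007,6100001110807,41002110903,11100403050102]
   (.cut 708 [1070506120911,9110005121006,12080001111007,6110403120809,9111210050102]
    (.X [(8,0)] [9,7])
    (.cut 193 [12110304050100,9080201121107,12110908100107,11120102090403]
    (.X [(2,0),(0,0),(5,0),(1,0)] [6,11,10,7,3,4])
    (.X [(2,0),(5,0),(0,0),(7,0),(1,0)] [6,10,4,3,8])))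
   (.cut 193 [11100304050100,9080201111007,6100201110807,10110102090403]
   (.X [(0,0),(1,0),(2,704),(5,0)] [4,3,9,10,6,7])
   (.X [(2,704),(1,0),(0,0),(5,0)] [4,3,9,6,7]))))
  (.X [(3,0)] [4,2])))))
 (.X [(7,64),(1,0)] [6,0,2,5]))

def fkC1 : List ℕ := [9080304050100]

def fkC2 : List ℕ := [10090403050102]

def fkC30 : List ℕ := [2030800111004,3110500100701,11031001090502,9110500100304,11100302070001,7090005100311,9070500111001,11051001090302,11070302100001,2051004110800,10110005090302]

def certC0 : Cert :=
 (.cut 776 [8110102120403,1070506121108,12060400110708,11031001120502,3110100120608,12070400110608,11080201120400,12110400070608,10120008090311,3110500100712]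
 (.good 31 [0,4,3,11,8])
 (.cut 1800 [8110102120403,1070506121108,8110201120410,80203121011,12060400110708,3110100120608,5120701110410]
 (.X [(5,264)] [6,8,0,3,2,11,9,1,7])
 (.cut 552 [8120102110403,8060102121105,7090005120311,8060102121109,12060400110205,11091001120807,3110100120605,12110400060205,11120201080400]
 (.X [(11,4)] [3,2,5,9])
 (.cut 1032 [40902121103,11030001120902,8120102110403,6120201110410,7080205110412]
 (.X [(5,784)] [2,9,6,8,0,4,1,7])
 (.cut 520 [8120102110403,8060102121109,11031001120502,11030500121004,4120102110609,10121109080506,11120201080400]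
 (.cut 3200 [4100807131112,12110102130403,6080201131207,10120609130311,10120008130907]
  (.X [(8,0),(9,0),(7,0),(0,0),(1,0),(12,0),(2,0),(3,0),(5,0),(10,0),(4,0)] [11,6])
  (.cut 1152 [13121109080107,13111207060209,12071306110209,6080201131207,10120008130907]
  (.cut 2112 [7090403141311,13110102140403,13140201120410]
   (.X [(12,2320)] [4,10,7,8,11,0,1])
   (.cut 6208 [13110102140403,7090403141311,10120806141113]
   (.cut 6416 [9110004151214,9060100151408]
    (.X [(4,0),(2,0),(3,9248)] [5,0,1,10,14,11,13,9,6,12,8,7])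
    (.X [(13,1064),(8,0),(7,0),(12,0)] [10,1,0,5,6,9,11,3,2]))
   (.X [(8,6160),(6,0)] [4,0,5,12,7,9,11,1,2,10])))
  (.X [(7,2116)] [2,9,1,6,8,11,0,5])))
 (.cut 1064 [40902121103,1100605120311,12060400110205,11030001120902,8120102110403,3110100120605,6120201110410,5110701120410,7120005100311]
 (.cut 272 [13120500100304,11030100131204,13100500120304]
  (.X [(12,1152)] [7,8,4,10,0,1])
  (.X [(5,0),(8,0),(0,0),(1,0),(4,0),(3,0),(9,0),(2,0)] [10,11,6,7]))
 (.cut 1152 [11070400120608,11120400060205,11100203120004,10110008120907,6080201121107,6120201110410,11120302060005]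
 (.cut 64 [7080205131206,12060400130205,11071206130209,12130201110410,12130500100304]
  (.cut 2320 [14121308090506,14130500100304,9060100141308,11130005120314]
   (.X [(12,32)] [6,5])
   (.X [(2,0),(0,0),(6,0),(1,0),(7,0),(9,0),(8,0),(4,0),(10,0)] [11,12,5,3]))
  (.cut 2112 [4100807131211,12060400130205,11121309080506]
  (.cut 2320 [14120907131011,14130500100304,9060100141308,6120203131014]
   (.cut 5640 [13040102151403,15141107060209]
    (.cut 12328 [40902161503,16150102140403]
     (.X [(2,0),(10,0),(0,0),(14,0),(6,0),(5,0),(3,0),(8,0),(7,0),(11,0),(15,0),(1,0),(12,0),(13,0),(9,0),(4,0)] [])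
     (.good 31 [1,2,9,14,10]))
    (.X [(4,0),(9,0),(2,0),(3,12320)] [7,1,10,0,5,6,12,13,8,11]))
   (.cut 5640 [7110506141312,14131107060209]
   (.good 31 [1,2,3,13,10])
   (.X [(0,0),(6,0),(2,0),(1,0),(8,0),(9,0),(10,0),(7,0),(11,0),(4,0)] [12,5,3])))
  (.X [(8,2064),(6,0)] [11,7,9,5,0,4,1,2,10])))
 (.cut 1544 [8120102110403,1100609120311,10111206070209,4120102110609,6120201110410,8060102121109]
 (.X [(7,68)] [2,1,9,6,8,5,0])
 (.X [(9,288)] [5,6,8,2,7,0,1])))))))))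

def fkC31 : List ℕ := [6080201110410,9070500111001,9110500100304,3110500100708,11051001090302,11031001090502,3110500100701,11070302100001,9070500111008,3110906100008,11100302070001,10110005090302]

def certC1 : Cert :=
 (.X [(10,1)] [1,0,4,8])

def fkC32 : List ℕ := [2030800111004,3110500100701,9100500110304,4100502110709,11100302070001,11060302100709,11070302100001,2051004110800,10090005110302,4100806110209,6090304110110]

def certC2 : Cert :=
 (.X [(7,1088)] [9,6,8,10,1,2,5,0])

def fkC33 : List ℕ := [3110500100701,9100500110304,6080201110410,3110500100708,11060302100709,11070302100001,10090005110302,4100502110709,11100302070001]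

def certC3 : Cert :=
 (.X [(1,528)] [10,9,4,0,2,7,8,6,5])

/-! ### Kernel-checked certificates -/

/-- Remove the traces in `l` from `E`. -/
def xcl (l E : List ℕ) : List ℕ := E.filter (fun t => !(l.any (Nat.beq t)))

def EB : List ℕ := filtF rowsB fkB (rootE rowsB)

def bad0 : List ℕ := [32, 160, 66, 2]
def bad1 : List ℕ := bad0 ++ [201, 212]
def bad2 : List ℕ := bad1 ++ [72, 80, 136, 144]
def bad3 : List ℕ := bad2 ++ [73, 84, 137, 148]
def bad4 : List ℕ := bad3 ++ [34]
def bad5 : List ℕ := bad4 ++ [197]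
def bad6 : List ℕ := bad5 ++ [200, 208]
def bad7 : List ℕ := bad6 ++ [42, 50]
def bad8 : List ℕ := bad7 ++ [192]

/-- Adding a vertex of trace `s` and then running the certificate. -/
def checkChild (gs rows E : List ℕ) (s : ℕ) (fk : List ℕ) (c : Cert) : Bool :=
  check gs c (addv rows s) (childE rows E s fk)

lemma ckR1 : check [31] certR1 rowsA (filtF rowsA fkA (rootE rowsA)) = true := by decide +kernel

lemma ckR2 : checkChild [31] (addv rowsB 32) (childE rowsB EB 32 fkR2a) 2 fkR2b certR2 = true := by
  decide +kernel

lemma ckR2c : checkChild [31] rowsB (xcl [32, 160, 66] EB) 2 fkR2c certR2c = true := by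
  decide +kernel

lemma ckS0 : checkChild [31, 61] rowsB (xcl bad0 EB) 212 fkS0 certS0 = true := by decide +kernel
lemma ckS1 : checkChild [31, 61] rowsB (xcl bad1 EB) 144 fkS1 certS1 = true := by decide +kernel
lemma ckS2 : checkChild [31, 61] rowsB (xcl bad2 EB) 148 fkS2 certS2 = true := by decide +kernel
lemma ckS3 : checkChild [31, 61] rowsB (xcl bad3 EB) 34 fkS3 certS3 = true := by decide +kernel
lemma ckS4 : checkChild [31, 61] rowsB (xcl bad4 EB) 197 fkS4 certS4 = true := by decide +kernel
lemma ckS5 : checkChild [31, 61] rowsB (xcl bad5 EB) 208 fkS5 certS5 = true := by decide +kernel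
lemma ckS6 : checkChild [31, 61] rowsB (xcl bad6 EB) 50 fkS6 certS6 = true := by decide +kernel
lemma ckS7 : checkChild [31, 61] rowsB (xcl bad7 EB) 192 fkS7 certS7 = true := by decide +kernel

lemma ckA : check [31, 61] certA rowsB (xcl (bad8 ++ [193]) EB) = true := by decide +kernel
lemma ckB : check [31, 61] certB rowsB (xcl (bad8 ++ [10, 18, 40, 48]) EB) = true := by
  decide +kernel

def rowsC1 : List ℕ := addv rowsB 193
def EC1 : List ℕ := childE rowsB (xcl bad8 EB) 193 fkC1
def rowsC2 : List ℕ := addv rowsC1 196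
def EC2 : List ℕ := childE rowsC1 EC1 196 fkC2

lemma ckC0 : checkChild [31, 61] rowsC2 EC2 18 fkC30 certC0 = true := by decide +kernel
lemma ckC1 : checkChild [31, 61] rowsC2 EC2 274 fkC31 certC1 = true := by decide +kernel
lemma ckC2 : checkChild [31, 61] rowsC2 EC2 530 fkC32 certC2 = true := by decide +kernel
lemma ckC3 : checkChild [31, 61] rowsC2 EC2 786 fkC33 certC3 = true := by decide +kernel

lemma EC1_only : EC1.all (fun t => !(Nat.beq (t % 256) 196) || Nat.beq t 196) = true := by
  decide +kernel

lemma EC2_only : EC2.all (fun t => !(Nat.beq (t % 256) 18) ||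
    (Nat.beq t 18 || (Nat.beq t 274 || (Nat.beq t 530 || Nat.beq t 786)))) = true := by
  decide +kernel

lemma EB_U : EB.all (fun t => !(Nat.beq (t &&& 31) 0 && t.testBit 5) ||
    (Nat.beq t 32 || Nat.beq t 160)) = true := by
  decide +kernel

lemma EB_W : EB.all (fun t => !(Nat.beq (t &&& 63) 2) || (Nat.beq t 2 || Nat.beq t 66)) = true := by
  decide +kernel

/-! ### Configurations -/

structure Cfg (G : SimpleGraph V) (gs rows : List ℕ) (f : ℕ → V) : Prop where
  inj : ∀ i < rows.length, ∀ j < rows.length, f i = f j → i = j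
  adj : ∀ i < rows.length, ∀ j < rows.length, (G.Adj (f i) (f j) ↔ adjK rows i j = true)
  good : ∀ C ∈ gs, (∀ i, C.testBit i = true → i < rows.length) ∧
    ∀ D : Fin 5 → V, IsC5 G D → (uncM G f C).ncard ≤ (unc G D).ncard

lemma Inv.cfg {G : SimpleGraph V} {gs rows E : List ℕ} {f : ℕ → V} (h : Inv G gs rows E f) :
    Cfg G gs rows f := ⟨h.inj, h.adj, h.good⟩

lemma rows_lt (rows : List ℕ) (h : rows.all (fun r => Nat.blt r (2 ^ rows.length)) = true) :
    ∀ i j, adjK rows i j = true → j < rows.length := by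
  intro i j hij
  by_contra hj
  unfold adjK at hij
  by_cases hi : i < rows.length
  · have h1 := List.all_eq_true.1 h _ (List.getElem_mem hi)
    rw [Nat.blt_eq] at h1
    rw [List.getD_eq_getElem _ _ hi, Nat.testBit_lt_two_pow
      (lt_of_lt_of_le h1 (Nat.pow_le_pow_right (by norm_num) (by omega)))] at hij
    exact Bool.noConfusion hij
  · rw [List.getD_eq_default _ _ (by omega)] at hij
    simp at hij

lemma Cfg.root {G : SimpleGraph V} (hG : Ctx G) {gs rows : List ℕ} {f : ℕ → V}
    (h : Cfg G gs rows f) (hr : rows.all (fun r => Nat.blt r (2 ^ rows.length)) = true) :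
    Inv G gs rows (rootE rows) f :=
  root_sound hG h.inj h.adj (rows_lt rows hr) h.good

lemma Cfg.invB {G : SimpleGraph V} (hG : Ctx G) {gs : List ℕ} {f : ℕ → V}
    (h : Cfg G gs rowsB f) : Inv G gs rowsB EB f :=
  filtF_sound hG fkB _ (h.root hG (by decide))

/-- No fresh vertex has trace `s`. -/
def NoTr (G : SimpleGraph V) (n : ℕ) (f : ℕ → V) (s : ℕ) : Prop :=
  ∀ v, (∀ i < n, v ≠ f i) → ¬ Tr G n f v s

lemma Inv.xcl {G : SimpleGraph V} {gs rows E : List ℕ} {f : ℕ → V}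
    (hI : Inv G gs rows E f) (l : List ℕ) (h : ∀ s ∈ l, NoTr G rows.length f s) :
    Inv G gs rows (xcl l E) f := by
  refine ⟨hI.inj, hI.adj, hI.lt, ?_, hI.good⟩
  intro v hv
  obtain ⟨t, ht, htr⟩ := hI.tr v hv
  refine ⟨t, List.mem_filter.2 ⟨ht, ?_⟩, htr⟩
  by_contra hc
  simp only [Bool.not_eq_true', Bool.not_eq_false] at hc
  obtain ⟨s, hs, hts⟩ := List.any_eq_true.1 hc
  exact h s hs v hv (Nat.eq_of_beq_eq_true hts ▸ htr)

lemma Tr.lt {G : SimpleGraph V} {n : ℕ} {f : ℕ → V} {v : V} {t : ℕ} (h : Tr G n f v t) :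
    t < 2 ^ n := by
  refine Nat.lt_pow_two_of_testBit _ fun i hi => ?_
  by_contra hc
  have := ((h i).1 (by simpa using hc)).1
  omega

lemma Tr.mod {G : SimpleGraph V} {n m : ℕ} {f g : ℕ → V} {v : V} {s t : ℕ} (h : Tr G n f v s)
    (h' : Tr G m g v t) (hnm : n ≤ m) (hfg : ∀ i < n, g i = f i) : t % 2 ^ n = s := by
  refine Nat.eq_of_testBit_eq fun j => ?_
  rw [Nat.testBit_mod_two_pow, Bool.eq_iff_iff, h j, Bool.and_eq_true, h' j, decide_eq_true_eq]
  constructor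
  · rintro ⟨h1, h2, h3⟩
    exact ⟨h1, by rwa [hfg j h1] at h3⟩
  · rintro ⟨h1, h2⟩
    exact ⟨h1, by omega, by rwa [hfg j h1]⟩

lemma Tr.uniq {G : SimpleGraph V} {n : ℕ} {f : ℕ → V} {v : V} {s t : ℕ} (h : Tr G n f v s)
    (ht : Tr G n f v t) : s = t := by
  rw [← h.mod ht le_rfl fun _ _ => rfl, Nat.mod_eq_of_lt ht.lt]

/-- Constructing a trace from finitely many checks. -/
lemma Tr.mk' {G : SimpleGraph V} {n : ℕ} {f : ℕ → V} {v : V} {s : ℕ} (hs : s < 2 ^ n)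
    (h : ∀ j < n, (s.testBit j = true ↔ G.Adj v (f j))) : Tr G n f v s := by
  intro j
  by_cases hj : j < n
  · rw [h j hj]; exact ⟨fun h => ⟨hj, h⟩, fun h => h.2⟩
  · have : s.testBit j = false := Nat.testBit_lt_two_pow
      (lt_of_lt_of_le hs (Nat.pow_le_pow_right (by norm_num) (by omega)))
    rw [this]
    constructor
    · intro h; exact Bool.noConfusion h
    · intro h; exact absurd h.1 hj

/-! ### Replacing a vertex -/

lemma updF_ne (f : ℕ → V) {n : ℕ} (v : V) {i : ℕ} (h : i ≠ n) : updF f n v i = f i := if_neg h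

lemma updF_self (f : ℕ → V) (n : ℕ) (v : V) : updF f n v n = v := if_pos rfl

lemma Cfg.replace {G : SimpleGraph V} {gs rows rows' : List ℕ} {f : ℕ → V}
    (h : Cfg G gs rows f) (k s : ℕ) (v : V) (hv : ∀ i < rows.length, v ≠ f i)
    (hs : Tr G rows.length f v s) (hlen : rows'.length = rows.length)
    (hr : ∀ i < rows.length, ∀ j < rows.length, adjK rows' i j =
      if i = k then (if j = k then false else s.testBit j)
      else if j = k then s.testBit i else adjK rows i j)
    (hgs : ∀ C ∈ gs, C.testBit k = false) : Cfg G gs rows' (updF f k v) := by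
  refine ⟨?_, ?_, ?_⟩
  · rw [hlen]
    intro i hi j hj hij
    by_cases hik : i = k <;> by_cases hjk : j = k
    · omega
    · rw [hik, updF_self, updF_ne _ _ hjk] at hij
      exact absurd hij (hv j hj)
    · rw [hjk, updF_self, updF_ne _ _ hik] at hij
      exact absurd hij.symm (hv i hi)
    · rw [updF_ne _ _ hjk, updF_ne _ _ hik] at hij
      exact h.inj i hi j hj hij
  · rw [hlen]
    intro i hi j hj
    rw [hr i hi j hj]
    by_cases hik : i = k <;> by_cases hjk : j = k
    · rw [hik, hjk]; simp
    · rw [if_pos hik, if_neg hjk, hik, updF_self, updF_ne _ _ hjk, hs j]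
      exact ⟨fun h => ⟨hj, h⟩, fun h => h.2⟩
    · rw [if_neg hik, if_pos hjk, hjk, updF_self, updF_ne _ _ hik, hs i, G.adj_comm]
      exact ⟨fun h => ⟨hi, h⟩, fun h => h.2⟩
    · rw [if_neg hik, if_neg hjk, updF_ne _ _ hjk, updF_ne _ _ hik, h.adj i hi j hj]
  · intro C hC
    obtain ⟨h1, h2⟩ := h.good C hC
    refine ⟨by rwa [hlen], ?_⟩
    have : uncM G (updF f k v) C = uncM G f C := by
      ext w
      refine forall_congr' fun i => ?_
      by_cases hi : C.testBit i = true
      · have : i ≠ k := by rintro rfl; rw [hgs C hC] at hi; exact Bool.noConfusion hi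
        rw [updF_ne _ _ this]
      · simp [hi]
    rw [this]; exact h2

/-! ### The claims R1, R2 -/

lemma no_rowsA [Fintype V] {G : SimpleGraph V} (hG : Ctx G) {f : ℕ → V}
    (h : Cfg G [31] rowsA f) : False :=
  check_sound hG certR1 (filtF_sound hG fkA _ (h.root hG (by decide))) ckR1

lemma no160 [Fintype V] {G : SimpleGraph V} (hG : Ctx G) {f : ℕ → V}
    (h : Cfg G [31] rowsB f) : NoTr G 8 f 160 := by
  intro v hv hs
  exact no_rowsA hG (h.replace (rows' := rowsA) 6 160 v hv hs rfl (by decide) (by decide))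

lemma no66 [Fintype V] {G : SimpleGraph V} (hG : Ctx G) {f : ℕ → V}
    (h : Cfg G [31] rowsB f) : NoTr G 8 f 66 := by
  intro v hv hs
  exact no_rowsA hG (h.replace (rows' := rowsA) 7 66 v hv hs rfl (by decide) (by decide))

/-- Uncovered vertices adjacent to `f 5`. -/
def Us (G : SimpleGraph V) (f : ℕ → V) : Set V := {v | v ∈ uncM G f 31 ∧ G.Adj v (f 5)}

/-- Private neighbours of `f 1`. -/
def Ws (G : SimpleGraph V) (f : ℕ → V) : Set V :=
  {v | G.Adj v (f 1) ∧ ∀ i < 6, i ≠ 1 → v ≠ f i ∧ ¬ G.Adj v (f i)}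

lemma bits31 : ∀ i, Nat.testBit 31 i = true ↔ i < 5 := by
  intro i
  constructor
  · intro h
    by_contra hc
    rw [Nat.testBit_lt_two_pow (lt_of_lt_of_le (by norm_num : 31 < 2 ^ 5)
      (Nat.pow_le_pow_right (by norm_num) (by omega)))] at h
    exact Bool.noConfusion h
  · intro h; interval_cases i <;> rfl

lemma bits61 : ∀ i, Nat.testBit 61 i = true ↔ i < 6 ∧ i ≠ 1 := by
  intro i
  constructor
  · intro h
    by_contra hc
    by_cases hi : i = 1
    · subst hi; exact Bool.noConfusion h
    rw [Nat.testBit_lt_two_pow (lt_of_lt_of_le (by norm_num : 61 < 2 ^ 6)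
      (Nat.pow_le_pow_right (by norm_num) (by omega)))] at h
    exact Bool.noConfusion h
  · rintro ⟨h, h'⟩; interval_cases i <;> first | rfl | exact absurd rfl h'

lemma unc61_sub {G : SimpleGraph V} {f : ℕ → V} (h10 : G.Adj (f 1) (f 0)) :
    uncM G f 61 ⊆ (uncM G f 31 \ Us G f) ∪ Ws G f := by
  intro v hv
  have hv' : ∀ i < 6, i ≠ 1 → v ≠ f i ∧ ¬ G.Adj v (f i) := fun i hi h1 =>
    hv i ((bits61 i).2 ⟨hi, h1⟩)
  by_cases h : G.Adj v (f 1)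
  · exact Or.inr ⟨h, hv'⟩
  · left
    refine ⟨?_, fun hu => (hv' 5 (by norm_num) (by norm_num)).2 hu.2⟩
    intro i hi
    rw [bits31] at hi
    by_cases h1 : i = 1
    · subst h1
      exact ⟨fun he => (hv' 0 (by norm_num) (by norm_num)).2 (he ▸ h10), h⟩
    · exact hv' i (by omega) h1

lemma uncM61 {G : SimpleGraph V} (f : ℕ → V) :
    unc G ![f 0, f 5, f 2, f 3, f 4] = uncM G f 61 := by
  ext v
  simp only [unc, uncM, Set.mem_ofPred_eq, bits61]
  constructor
  · intro h i hi
    obtain ⟨hi, h1⟩ := hi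
    interval_cases i
    · exact h 0
    · exact absurd rfl h1
    · exact h 2
    · exact h 3
    · exact h 4
    · exact h 1
  · intro h i
    fin_cases i
    · exact h 0 (by norm_num)
    · exact h 5 (by norm_num)
    · exact h 2 (by norm_num)
    · exact h 3 (by norm_num)
    · exact h 4 (by norm_num)

/-- The root configuration without the private neighbour. -/
def rows7 : List ℕ := [50, 5, 42, 20, 9, 69, 32]

lemma Cfg.isC5 {G : SimpleGraph V} {gs : List ℕ} {f : ℕ → V}
    (h : Cfg G gs rows7 f) : IsC5 G ![f 0, f 5, f 2, f 3, f 4] := by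
  constructor
  · have e : (![f 0, f 5, f 2, f 3, f 4] : Fin 5 → V) =
        fun i => f ((![0, 5, 2, 3, 4] : Fin 5 → ℕ) i) := by
      funext i; fin_cases i <;> rfl
    rw [e]
    intro i j hij
    have hl : ∀ i, (![0, 5, 2, 3, 4] : Fin 5 → ℕ) i < 7 := by decide
    have := h.inj _ (hl i) _ (hl j) hij
    clear hij
    revert i j
    decide
  · intro i
    fin_cases i
    · exact (h.adj 0 (by decide) 5 (by decide)).2 rfl
    · exact (h.adj 5 (by decide) 2 (by decide)).2 rfl
    · exact (h.adj 2 (by decide) 3 (by decide)).2 rfl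
    · exact (h.adj 3 (by decide) 4 (by decide)).2 rfl
    · exact (h.adj 4 (by decide) 0 (by decide)).2 rfl

lemma Cfg.to7 {G : SimpleGraph V} {f : ℕ → V} (h : Cfg G [31] rowsB f) : Cfg G [31] rows7 f := by
  refine ⟨?_, ?_, ?_⟩
  · intro i hi j hj
    have hi' : i < 7 := hi
    have hj' : j < 7 := hj
    exact h.inj i (show i < 8 by omega) j (show j < 8 by omega)
  · intro i hi j hj
    have hi' : i < 7 := hi
    have hj' : j < 7 := hj
    rw [h.adj i (show i < 8 by omega) j (show j < 8 by omega)]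
    have key : ∀ i < 7, ∀ j < 7, adjK rowsB i j = adjK rows7 i j := by decide
    rw [key i hi' j hj']
  · intro C hC
    refine ⟨?_, (h.good C hC).2⟩
    rw [List.mem_singleton.1 hC]
    intro i hi
    rw [bits31] at hi
    exact show i < 7 by omega

lemma card_U_le_W [Fintype V] {G : SimpleGraph V} {f : ℕ → V} (h : Cfg G [31] rows7 f) :
    (Us G f).ncard ≤ (Ws G f).ncard := by
  have c1 := (h.good 31 (by simp)).2 _ h.isC5
  rw [uncM61] at c1
  have c2 := Set.ncard_le_ncard
    (unc61_sub ((h.adj 1 (by decide) 0 (by decide)).2 rfl)) (Set.toFinite _)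
  have c3 := Set.ncard_union_le (uncM G f 31 \ Us G f) (Ws G f)
  have c4 := Set.ncard_sdiff_add_ncard_of_subset
    (show Us G f ⊆ uncM G f 31 from fun v hv => hv.1) (Set.toFinite _)
  omega

lemma U_mem {G : SimpleGraph V} (hG : Ctx G) {f : ℕ → V} (h : Cfg G [31] rowsB f) (v : V)
    (hv : v ∈ Us G f) (h6 : v ≠ f 6) : (∀ i < 8, v ≠ f i) ∧ (Tr G 8 f v 32 ∨ Tr G 8 f v 160) := by
  have hfr : ∀ i < 8, v ≠ f i := by
    intro i hi he
    have hne : i ≠ 6 := by rintro rfl; exact h6 he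
    have h5 := hv.2
    rw [he, h.adj i hi 5 (by decide)] at h5
    have key : ∀ i < 8, i ≠ 6 → adjK rowsB i 5 = true → i < 5 := by decide
    exact (hv.1 i ((bits31 i).2 (key i hi hne h5))).1 he
  refine ⟨hfr, ?_⟩
  obtain ⟨t, ht, htr⟩ := (h.invB hG).tr v hfr
  have hk := List.all_eq_true.1 EB_U t ht
  have h5 : t.testBit 5 = true := (htr 5).2 ⟨by decide, hv.2⟩
  have h0 : t &&& 31 = 0 := by
    refine Nat.eq_of_testBit_eq fun j => ?_
    rw [Nat.testBit_land, Nat.zero_testBit, Bool.eq_false_iff]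
    intro hc
    rw [Bool.and_eq_true] at hc
    exact (hv.1 j hc.2).2 ((htr j).1 hc.1).2
  rw [h0, h5] at hk
  simp only [Nat.beq_refl, Bool.and_self, Bool.not_true, Bool.false_or, Bool.or_eq_true] at hk
  rcases hk with hk | hk
  · left; rw [← Nat.eq_of_beq_eq_true hk]; exact htr
  · right; rw [← Nat.eq_of_beq_eq_true hk]; exact htr

lemma W_mem {G : SimpleGraph V} (hG : Ctx G) {f : ℕ → V} (h : Cfg G [31] rowsB f) (v : V)
    (hv : v ∈ Ws G f) (h7 : v ≠ f 7) : (∀ i < 8, v ≠ f i) ∧ (Tr G 8 f v 2 ∨ Tr G 8 f v 66) := by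
  have hfr : ∀ i < 8, v ≠ f i := by
    intro i hi he
    have hne : i ≠ 7 := by rintro rfl; exact h7 he
    have h5 := hv.1
    rw [he, h.adj i hi 1 (by decide)] at h5
    have key : ∀ i < 8, i ≠ 7 → adjK rowsB i 1 = true → i < 6 ∧ i ≠ 1 := by decide
    exact (hv.2 i (key i hi hne h5).1 (key i hi hne h5).2).1 he
  refine ⟨hfr, ?_⟩
  obtain ⟨t, ht, htr⟩ := (h.invB hG).tr v hfr
  have hk := List.all_eq_true.1 EB_W t ht
  have h0 : t &&& 63 = 2 := by
    refine Nat.eq_of_testBit_eq fun j => ?_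
    rw [Nat.testBit_land]
    by_cases hj : j < 6
    · by_cases hj1 : j = 1
      · subst hj1
        rw [(htr 1).2 ⟨by decide, hv.1⟩]; rfl
      · have : t.testBit j = false :=
          Bool.eq_false_iff.2 fun hc => (hv.2 j hj hj1).2 ((htr j).1 hc).2
        rw [this]
        interval_cases j <;> first | rfl | exact absurd rfl hj1
    · rw [Nat.testBit_lt_two_pow (x := 63) (lt_of_lt_of_le (by norm_num : 63 < 2 ^ 6)
        (Nat.pow_le_pow_right (by norm_num) (by omega))),
        Nat.testBit_lt_two_pow (x := 2) (lt_of_lt_of_le (by norm_num : 2 < 2 ^ 6)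
        (Nat.pow_le_pow_right (by norm_num) (by omega))), Bool.and_false]
  rw [h0] at hk
  simp only [Nat.beq_refl, Bool.not_true, Bool.false_or, Bool.or_eq_true] at hk
  rcases hk with hk | hk
  · left; rw [← Nat.eq_of_beq_eq_true hk]; exact htr
  · right; rw [← Nat.eq_of_beq_eq_true hk]; exact htr

lemma f6_mem_U {G : SimpleGraph V} {f : ℕ → V} (h : Cfg G [31] rows7 f) : f 6 ∈ Us G f := by
  refine ⟨?_, (h.adj 6 (by decide) 5 (by decide)).2 rfl⟩
  intro i hi
  rw [bits31] at hi
  have hi' : i < 7 := by omega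
  refine ⟨fun he => ?_, fun ha => ?_⟩
  · have := h.inj 6 (by decide) i hi' he; omega
  · rw [h.adj 6 (by decide) i hi'] at ha
    have key : ∀ i < 5, adjK rows7 6 i = false := by decide
    rw [key i hi] at ha
    exact Bool.noConfusion ha

lemma Tr.ne {G : SimpleGraph V} {n : ℕ} {f : ℕ → V} {v w : V} {s t : ℕ} (h : Tr G n f v s)
    (h' : Tr G n f w t) (hst : s ≠ t) : v ≠ w := by
  rintro rfl; exact hst (h.uniq h')

lemma no32 [Fintype V] {G : SimpleGraph V} (hG : Ctx G) {f : ℕ → V}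
    (h : Cfg G [31] rowsB f) : NoTr G 8 f 32 := by
  intro v hv hs
  have hvU : v ∈ Us G f := by
    refine ⟨fun i hi => ?_, ((hs 5).1 rfl).2⟩
    rw [bits31] at hi
    refine ⟨hv i (by omega), fun ha => ?_⟩
    have := (hs i).2 ⟨by omega, ha⟩
    interval_cases i <;> exact Bool.noConfusion this
  have h2 : 1 < (Us G f).ncard :=
    (Set.one_lt_ncard (Set.toFinite _)).2 ⟨v, hvU, f 6, f6_mem_U h.to7, hv 6 (by norm_num)⟩
  have h3 : 1 < (Ws G f).ncard := lt_of_lt_of_le h2 (card_U_le_W h.to7)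
  obtain ⟨w, hw, hw7⟩ := Set.exists_ne_of_one_lt_ncard h3 (f 7)
  obtain ⟨hwf, hwt⟩ := W_mem hG h w hw hw7
  have hwt : Tr G 8 f w 2 := hwt.resolve_right (no66 hG h w hwf)
  have hwv : w ≠ v := hwt.ne hs (by norm_num)
  have h' : Cfg G [31] rowsB (updF f 6 v) :=
    h.replace (rows' := rowsB) 6 32 v hv hs rfl (by decide) (by decide)
  have hnadj : ¬ G.Adj w v := by
    intro ha
    refine no66 hG h' w ?_ ?_
    · intro i hi
      by_cases hi6 : i = 6
      · rw [hi6, updF_self]; exact hwv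
      · rw [updF_ne _ _ hi6]; exact hwf i hi
    · refine Tr.mk' (by norm_num) fun j hj => ?_
      by_cases hj6 : j = 6
      · subst hj6; rw [updF_self]; exact ⟨fun _ => ha, fun _ => rfl⟩
      · rw [updF_ne _ _ hj6]
        have := hwt j
        have key : ∀ j < 8, j ≠ 6 → Nat.testBit 66 j = Nat.testBit 2 j := by decide
        rw [key j hj hj6, this]
        exact ⟨fun h => h.2, fun h => ⟨hj, h⟩⟩
  have hI := child_sound hG (h.invB hG) 32 fkR2a v hv hs
  have hlen : (addv rowsB 32).length = 9 := rfl
  have hwf' : ∀ i < (addv rowsB 32).length, w ≠ updF f rowsB.length v i := by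
    intro i hi
    by_cases hi6 : i = 8
    · rw [hi6]; exact hwv
    · rw [updF_ne _ _ (show i ≠ rowsB.length from hi6)]; exact hwf i (by omega)
  have hwt' : Tr G (addv rowsB 32).length (updF f rowsB.length v) w 2 := by
    refine Tr.mk' (by norm_num [hlen]) fun j hj => ?_
    by_cases hj6 : j = 8
    · subst hj6
      constructor
      · intro h; exact Bool.noConfusion h
      · intro h; exact absurd h hnadj
    · rw [updF_ne _ _ (show j ≠ rowsB.length from hj6), hwt j]
      exact ⟨fun h => h.2, fun h => ⟨by omega, h⟩⟩
  exact check_sound hG certR2 (child_sound hG hI 2 fkR2b w hwf' hwt') ckR2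

lemma no2 [Fintype V] {G : SimpleGraph V} (hG : Ctx G) {f : ℕ → V}
    (h : Cfg G [31] rowsB f) : NoTr G 8 f 2 := by
  intro v hv hs
  have hI : Inv G [31] rowsB (xcl [32, 160, 66] EB) f := by
    refine (h.invB hG).xcl _ ?_
    intro s hs
    simp only [List.mem_cons, List.not_mem_nil, or_false] at hs
    rcases hs with rfl | rfl | rfl
    · exact no32 hG h
    · exact no160 hG h
    · exact no66 hG h
  exact check_sound hG certR2c (child_sound hG hI 2 fkR2c v hv hs) ckR2c

lemma good61 [Fintype V] {G : SimpleGraph V} (hG : Ctx G) {f : ℕ → V}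
    (h : Cfg G [31] rowsB f) : Cfg G [31, 61] rowsB f := by
  refine ⟨h.inj, h.adj, ?_⟩
  intro C hC
  rcases List.mem_cons.1 hC with rfl | hC
  · exact h.good _ (by simp)
  rw [List.mem_singleton.1 hC]
  refine ⟨fun i hi => ?_, fun D hD => ?_⟩
  · rw [bits61] at hi; exact show i < 8 by omega
  · have hW : Ws G f ⊆ {f 7} := by
      intro v hv
      by_contra hne
      obtain ⟨hfr, ht⟩ := W_mem hG h v hv hne
      rcases ht with ht | ht
      · exact no2 hG h v hfr ht
      · exact no66 hG h v hfr ht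
    have c1 := (h.good 31 (by simp)).2 D hD
    have c2 := Set.ncard_le_ncard
      (unc61_sub (G := G) (f := f) ((h.adj 1 (by decide) 0 (by decide)).2 rfl)) (Set.toFinite _)
    have c3 := Set.ncard_union_le (uncM G f 31 \ Us G f) (Ws G f)
    have c4 := Set.ncard_sdiff_add_ncard_of_subset
      (show Us G f ⊆ uncM G f 31 from fun v hv => hv.1) (Set.toFinite _)
    have c5 := Set.ncard_le_ncard hW (Set.toFinite _)
    rw [Set.ncard_singleton] at c5
    have c6 : 0 < (Us G f).ncard :=
      (Set.ncard_pos (Set.toFinite _)).2 ⟨f 6, f6_mem_U h.to7⟩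
    omega

/-! ### Symmetries -/

def sigOf (l : List ℕ) (i : ℕ) : ℕ := l.getD i 0

def sig1 : List ℕ := [2, 1, 0, 4, 3, 5, 6, 7]
def sig2 : List ℕ := [0, 5, 2, 3, 4, 1, 7, 6]

/-- The permutation `l` preserves the configuration. -/
def SymOk (l : List ℕ) : Prop :=
  (∀ i < 8, sigOf l i < 8) ∧ (∀ i < 8, ∀ j < 8, sigOf l i = sigOf l j → i = j) ∧
  (∀ i < 8, ∀ j < 8, adjK rowsB (sigOf l i) (sigOf l j) = adjK rowsB i j) ∧
  ∀ C ∈ [31, 61], ∃ C' ∈ [31, 61],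
    (∀ i < 8, Nat.testBit C i = Nat.testBit C' (sigOf l i)) ∧
    (∀ j < 8, ∃ i < 8, sigOf l i = j)

lemma symOk1 : SymOk sig1 := by unfold SymOk; decide
lemma symOk2 : SymOk sig2 := by unfold SymOk; decide

lemma bits_lt8 : ∀ C ∈ [31, 61], ∀ i, Nat.testBit C i = true → i < 8 := by
  intro C hC i hi
  rcases List.mem_cons.1 hC with rfl | hC
  · rw [bits31] at hi; omega
  · rw [List.mem_singleton.1 hC, bits61] at hi; omega

lemma Cfg.sym {G : SimpleGraph V} {f : ℕ → V} {l : List ℕ} (hl : SymOk l)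
    (h : Cfg G [31, 61] rowsB f) : Cfg G [31, 61] rowsB (fun i => f (sigOf l i)) := by
  obtain ⟨h1, h2, h3, h4⟩ := hl
  refine ⟨?_, ?_, ?_⟩
  · intro i hi j hj hij
    exact h2 i hi j hj (h.inj _ (h1 i hi) _ (h1 j hj) hij)
  · intro i hi j hj
    rw [h.adj _ (h1 i hi) _ (h1 j hj), h3 i hi j hj]
  · intro C hC
    obtain ⟨C', hC', h5, h6⟩ := h4 C hC
    refine ⟨(h.good C hC).1, ?_⟩
    have : uncM G (fun i => f (sigOf l i)) C = uncM G f C' := by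
      ext v
      constructor
      · intro hv j hj
        obtain ⟨i, hi, rfl⟩ := h6 j (bits_lt8 C' hC' j hj)
        exact hv i (by rw [h5 i hi]; exact hj)
      · intro hv i hi
        exact hv (sigOf l i) (by rw [← h5 i (bits_lt8 C hC i hi)]; exact hi)
    rw [this]
    exact And.right (h.good C' hC')

lemma sig1_length : sig1.length = 8 := rfl

/-- No fresh vertex has trace `s` in any configuration. -/
def Pn (G : SimpleGraph V) (s : ℕ) : Prop :=
  ∀ f, Cfg G [31, 61] rowsB f → NoTr G 8 f s

lemma tr_sym {G : SimpleGraph V} {f : ℕ → V} {l : List ℕ} (hl : SymOk l) (s s' : ℕ) (v : V)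
    (hs' : s' < 256) (hss : ∀ j < 8, s'.testBit j = s.testBit (sigOf l j))
    (h : Tr G 8 f v s) : Tr G 8 (fun i => f (sigOf l i)) v s' := by
  refine Tr.mk' hs' fun j hj => ?_
  rw [hss j hj, h (sigOf l j)]
  exact ⟨fun h => h.2, fun h => ⟨hl.1 j hj, h⟩⟩

lemma Pn.sym {G : SimpleGraph V} {l : List ℕ} (hl : SymOk l) {s' : ℕ} (h : Pn G s') (s : ℕ)
    (hs' : s' < 256) (hss : ∀ j < 8, s'.testBit j = s.testBit (sigOf l j)) : Pn G s := by
  intro f hf v hv ht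
  exact h _ (hf.sym hl) v (fun i hi => hv _ (hl.1 i hi)) (tr_sym hl s s' v hs' hss ht)

lemma Pn.step [Fintype V] {G : SimpleGraph V} (hG : Ctx G) {bad : List ℕ}
    (hb : ∀ s ∈ bad, Pn G s) (s : ℕ) (fk : List ℕ) (c : Cert)
    (hck : checkChild [31, 61] rowsB (xcl bad EB) s fk c = true) : Pn G s := by
  intro f hf v hv ht
  have hI := (hf.invB hG).xcl bad fun s hs => hb s hs f hf
  exact check_sound hG c (child_sound hG hI s fk v hv ht) hck

lemma Cfg.to31 {G : SimpleGraph V} {f : ℕ → V} (h : Cfg G [31, 61] rowsB f) :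
    Cfg G [31] rowsB f :=
  ⟨h.inj, h.adj, fun C hC => h.good C (by rw [List.mem_singleton.1 hC]; simp)⟩

lemma forall_append {P : ℕ → Prop} {l l' : List ℕ} (h : ∀ s ∈ l, P s) (h' : ∀ s ∈ l', P s) :
    ∀ s ∈ l ++ l', P s := by
  intro s hs
  rcases List.mem_append.1 hs with hs | hs
  · exact h s hs
  · exact h' s hs

lemma hbad0 [Fintype V] {G : SimpleGraph V} (hG : Ctx G) : ∀ s ∈ bad0, Pn G s := by
  intro s hs f hf
  simp only [bad0, List.mem_cons, List.not_mem_nil, or_false] at hs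
  rcases hs with rfl | rfl | rfl | rfl
  · exact no32 hG hf.to31
  · exact no160 hG hf.to31
  · exact no66 hG hf.to31
  · exact no2 hG hf.to31

lemma hbad8 [Fintype V] {G : SimpleGraph V} (hG : Ctx G) : ∀ s ∈ bad8, Pn G s := by
  have one : ∀ {a : ℕ}, Pn G a → ∀ s ∈ [a], Pn G s := by
    intro a ha s hs; rw [List.mem_singleton.1 hs]; exact ha
  have two : ∀ {a b : ℕ}, Pn G a → Pn G b → ∀ s ∈ [a, b], Pn G s := by
    intro a b ha hb s hs
    rcases List.mem_cons.1 hs with rfl | hs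
    · exact ha
    · exact one hb s hs
  have h0 := hbad0 hG
  have p0 := Pn.step hG h0 212 _ _ ckS0
  have h1 : ∀ s ∈ bad1, Pn G s :=
    forall_append h0 (two (p0.sym symOk1 201 (by decide) (by decide)) p0)
  have p1 := Pn.step hG h1 144 _ _ ckS1
  have p1a : Pn G 136 := p1.sym symOk1 136 (by decide) (by decide)
  have p1b : Pn G 80 := p1.sym symOk2 80 (by decide) (by decide)
  have p1c : Pn G 72 := p1a.sym symOk2 72 (by decide) (by decide)
  have h2 : ∀ s ∈ bad2, Pn G s :=
    forall_append h1 (forall_append (l := [72, 80]) (two p1c p1b) (two p1a p1))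
  have p2 := Pn.step hG h2 148 _ _ ckS2
  have p2a : Pn G 137 := p2.sym symOk1 137 (by decide) (by decide)
  have p2b : Pn G 84 := p2.sym symOk2 84 (by decide) (by decide)
  have p2c : Pn G 73 := p2a.sym symOk2 73 (by decide) (by decide)
  have h3 : ∀ s ∈ bad3, Pn G s :=
    forall_append h2 (forall_append (l := [73, 84]) (two p2c p2b) (two p2a p2))
  have p3 := Pn.step hG h3 34 _ _ ckS3
  have h4 : ∀ s ∈ bad4, Pn G s := forall_append h3 (one p3)
  have p4 := Pn.step hG h4 197 _ _ ckS4
  have h5 : ∀ s ∈ bad5, Pn G s := forall_append h4 (one p4)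
  have p5 := Pn.step hG h5 208 _ _ ckS5
  have h6 : ∀ s ∈ bad6, Pn G s :=
    forall_append h5 (two (p5.sym symOk1 200 (by decide) (by decide)) p5)
  have p6 := Pn.step hG h6 50 _ _ ckS6
  have h7 : ∀ s ∈ bad7, Pn G s :=
    forall_append h6 (two (p6.sym symOk1 42 (by decide) (by decide)) p6)
  have p7 := Pn.step hG h7 192 _ _ ckS7
  exact forall_append h7 (one p7)

/-! ### The end of the proof -/

lemma ex193 [Fintype V] {G : SimpleGraph V} (hG : Ctx G) {f : ℕ → V}
    (hf : Cfg G [31, 61] rowsB f) : ∃ v, (∀ i < 8, v ≠ f i) ∧ Tr G 8 f v 193 := by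
  by_contra hc
  push Not at hc
  have hI := (hf.invB hG).xcl (bad8 ++ [193]) (forall_append (fun s hs => hbad8 hG s hs f hf) (by
    intro s hs; rw [List.mem_singleton.1 hs]; exact hc))
  exact check_sound hG certA hI ckA

lemma ex196 [Fintype V] {G : SimpleGraph V} (hG : Ctx G) {f : ℕ → V}
    (hf : Cfg G [31, 61] rowsB f) : ∃ v, (∀ i < 8, v ≠ f i) ∧ Tr G 8 f v 196 := by
  obtain ⟨v, hv, ht⟩ := ex193 hG (hf.sym symOk1)
  have key : ∀ i < 8, sigOf sig1 i < 8 ∧ sigOf sig1 (sigOf sig1 i) = i := by decide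
  refine ⟨v, fun i hi => ?_, ?_⟩
  · have := hv (sigOf sig1 i) (key i hi).1
    simp only [(key i hi).2] at this
    exact this
  · refine Tr.mk' (by decide) fun j hj => ?_
    have := ht (sigOf sig1 j)
    simp only [(key j hj).2] at this
    have k2 : ∀ j < 8, Nat.testBit 196 j = Nat.testBit 193 (sigOf sig1 j) := by decide
    rw [k2 j hj, this]
    exact ⟨fun h => h.2, fun h => ⟨(key j hj).1, h⟩⟩

lemma fresh_upd {n : ℕ} {f : ℕ → V} {v w : V} (hw : ∀ i < n, w ≠ f i) (hne : w ≠ v) :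
    ∀ i < n + 1, w ≠ updF f n v i := by
  intro i hi
  by_cases h : i = n
  · rw [h, updF_self]; exact hne
  · rw [updF_ne _ _ h]; exact hw i (by omega)

lemma p18 [Fintype V] {G : SimpleGraph V} (hG : Ctx G) : Pn G 18 := by
  intro f hf v hv ht
  obtain ⟨y, hy, hyt⟩ := ex193 hG hf
  obtain ⟨z, hz, hzt⟩ := ex196 hG hf
  have hI := (hf.invB hG).xcl bad8 (fun s hs => hbad8 hG s hs f hf)
  have hI1 : Inv G [31, 61] rowsC1 EC1 (updF f 8 y) := child_sound hG hI 193 fkC1 y hy hyt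
  have hz1 : ∀ i < 9, z ≠ updF f 8 y i := fresh_upd hz (hzt.ne hyt (by decide))
  have hv1 : ∀ i < 9, v ≠ updF f 8 y i := fresh_upd hv (ht.ne hyt (by decide))
  have e1 : ∀ i < 8, updF f 8 y i = f i := fun i hi => updF_ne _ _ (by omega)
  have hzt1 : Tr G 9 (updF f 8 y) z 196 := by
    obtain ⟨t, hE, htr⟩ := hI1.tr z hz1
    have hm : t % 256 = 196 := hzt.mod htr (show 8 ≤ 9 by omega) e1
    have hk := List.all_eq_true.1 EC1_only t hE
    rw [hm] at hk
    have : t = 196 := Nat.eq_of_beq_eq_true (by simpa using hk)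
    rw [← this]; exact htr
  have hI2 : Inv G [31, 61] rowsC2 EC2 (updF (updF f 8 y) 9 z) :=
    child_sound hG hI1 196 fkC2 z hz1 hzt1
  have hv2 : ∀ i < 10, v ≠ updF (updF f 8 y) 9 z i :=
    fresh_upd hv1 (ht.ne hzt (by decide))
  obtain ⟨t, hE, htr⟩ := hI2.tr v hv2
  have e2 : ∀ i < 8, updF (updF f 8 y) 9 z i = f i := fun i hi => by
    rw [updF_ne _ _ (by omega), updF_ne _ _ (by omega)]
  have hm : t % 256 = 18 := ht.mod htr (show 8 ≤ 10 by omega) e2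
  have hk := List.all_eq_true.1 EC2_only t hE
  rw [hm] at hk
  simp only [Nat.beq_refl, Bool.not_true, Bool.false_or, Bool.or_eq_true] at hk
  rcases hk with hk | hk | hk | hk <;> obtain rfl := Nat.eq_of_beq_eq_true hk
  · exact check_sound hG certC0 (child_sound hG hI2 18 fkC30 v hv2 htr) ckC0
  · exact check_sound hG certC1 (child_sound hG hI2 274 fkC31 v hv2 htr) ckC1
  · exact check_sound hG certC2 (child_sound hG hI2 530 fkC32 v hv2 htr) ckC2
  · exact check_sound hG certC3 (child_sound hG hI2 786 fkC33 v hv2 htr) ckC3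

lemma no_rowsB [Fintype V] {G : SimpleGraph V} (hG : Ctx G) {f : ℕ → V}
    (h : Cfg G [31] rowsB f) : False := by
  have hf := good61 hG h
  have q18 := p18 hG
  have q10 : Pn G 10 := q18.sym symOk1 10 (by decide) (by decide)
  have q48 : Pn G 48 := q18.sym symOk2 48 (by decide) (by decide)
  have q40 : Pn G 40 := q10.sym symOk2 40 (by decide) (by decide)
  have hI := (hf.invB hG).xcl (bad8 ++ [10, 18, 40, 48])
    (forall_append (fun s hs => hbad8 hG s hs f hf) (by
      intro s hs
      simp only [List.mem_cons, List.not_mem_nil, or_false] at hs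
      rcases hs with rfl | rfl | rfl | rfl
      · exact q10 f hf
      · exact q18 f hf
      · exact q40 f hf
      · exact q48 f hf))
  exact check_sound hG certB hI ckB

lemma no_rows7 [Fintype V] {G : SimpleGraph V} (hG : Ctx G) {f : ℕ → V}
    (h : Cfg G [31] rows7 f) : False := by
  have h1 : 0 < (Us G f).ncard := (Set.ncard_pos (Set.toFinite _)).2 ⟨f 6, f6_mem_U h⟩
  have h2 := lt_of_lt_of_le h1 (card_U_le_W h)
  obtain ⟨w, hw⟩ := (Set.ncard_pos (Set.toFinite _)).1 h2
  have hI := h.root hG (by decide)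
  have hfr : ∀ i < rows7.length, w ≠ f i := by
    intro i hi he
    have ha := hw.1
    rw [he, h.adj i hi 1 (by decide)] at ha
    have key : ∀ i < 7, adjK rows7 i 1 = true → i < 6 ∧ i ≠ 1 := by decide
    exact (hw.2 i (key i hi ha).1 (key i hi ha).2).1 he
  have tr : ∀ s, s < 128 → (∀ j < 6, s.testBit j = Nat.testBit 2 j) →
      (s.testBit 6 = true ↔ G.Adj w (f 6)) → Tr G rows7.length f w s := by
    intro s hs h1 h2
    refine Tr.mk' hs fun j hj => ?_
    have hj' : j < 7 := hj
    by_cases hj6 : j = 6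
    · rw [hj6]; exact h2
    · rw [h1 j (by omega)]
      by_cases hj1 : j = 1
      · subst hj1; exact ⟨fun _ => hw.1, fun _ => rfl⟩
      · have key : ∀ j < 6, j ≠ 1 → Nat.testBit 2 j = false := by decide
        rw [key j (by omega) hj1]
        constructor
        · intro h; exact Bool.noConfusion h
        · intro h; exact absurd h (hw.2 j (by omega) hj1).2
  by_cases ha : G.Adj w (f 6)
  · have := child_sound hG hI 66 [] w hfr
      (tr 66 (by decide) (by decide) ⟨fun _ => ha, fun _ => rfl⟩)
    exact no_rowsA hG (f := updF f 7 w) this.cfg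
  · have := child_sound hG hI 2 [] w hfr
      (tr 2 (by decide) (by decide) ⟨fun h => Bool.noConfusion h, fun h => absurd h ha⟩)
    exact no_rowsB hG (f := updF f 7 w) this.cfg

def rows5 : List ℕ := [18, 5, 10, 20, 9]

/-- The five-cycle `f 0, …, f 4` as a configuration. -/
lemma cfg5 {G : SimpleGraph V} (hG : Ctx G) (f : ℕ → V)
    (hinj : ∀ i < 5, ∀ j < 5, f i = f j → i = j)
    (h01 : G.Adj (f 0) (f 1)) (h12 : G.Adj (f 1) (f 2)) (h23 : G.Adj (f 2) (f 3))
    (h34 : G.Adj (f 3) (f 4)) (h40 : G.Adj (f 4) (f 0))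
    (hgood : ∀ D : Fin 5 → V, IsC5 G D → (uncM G f 31).ncard ≤ (unc G D).ncard) :
    Cfg G [31] rows5 f := by
  have n02 := hG.tri h01 h12
  have n13 := hG.tri h12 h23
  have n24 := hG.tri h23 h34
  have n30 := hG.tri h34 h40
  have n41 := hG.tri h40 h01
  refine ⟨hinj, ?_, ?_⟩
  · intro i hi j hj
    have hi' : i < 5 := hi
    have hj' : j < 5 := hj
    clear hi hj
    have pos : ∀ {p : Prop} {b : Bool}, p → b = true → (p ↔ b = true) :=
      fun hp hb => ⟨fun _ => hb, fun _ => hp⟩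
    have neg : ∀ {p : Prop} {b : Bool}, ¬ p → b = false → (p ↔ b = true) :=
      fun hp hb => ⟨fun h => absurd h hp, fun h => absurd (hb.symm.trans h) Bool.false_ne_true⟩
    interval_cases i <;> interval_cases j <;>
      first
      | exact neg (G.loopless.irrefl _) rfl
      | exact pos (by first | assumption | (rw [G.adj_comm]; assumption)) rfl
      | exact neg (by first | assumption | (rw [G.adj_comm]; assumption)) rfl
  · intro C hC
    rw [List.mem_singleton.1 hC]
    exact ⟨fun i hi => (bits31 i).1 hi, hgood⟩

lemma no_nbr [Fintype V] {G : SimpleGraph V} (hG : Ctx G) {f : ℕ → V}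
    (h : Cfg G [31] rows5 f) (x u : V) (h0 : G.Adj x (f 0)) (h2 : G.Adj x (f 2))
    (hu : u ∈ uncM G f 31) (hux : G.Adj u x) : False := by
  have hu' : ∀ i < 5, u ≠ f i ∧ ¬ G.Adj u (f i) := fun i hi => hu i ((bits31 i).2 hi)
  have hx : ∀ i < 5, x ≠ f i := by
    intro i hi he
    exact (hu' i hi).2 (he ▸ hux)
  have a01 : G.Adj (f 0) (f 1) := (h.adj 0 (by decide) 1 (by decide)).2 rfl
  have a04 : G.Adj (f 0) (f 4) := (h.adj 0 (by decide) 4 (by decide)).2 rfl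
  have a23 : G.Adj (f 2) (f 3) := (h.adj 2 (by decide) 3 (by decide)).2 rfl
  have t5 : Tr G 5 f x 5 := by
    refine Tr.mk' (by decide) fun j hj => ?_
    interval_cases j
    · exact ⟨fun _ => h0, fun _ => rfl⟩
    · exact ⟨fun h => Bool.noConfusion h, fun h => absurd h (hG.tri h0 a01)⟩
    · exact ⟨fun _ => h2, fun _ => rfl⟩
    · exact ⟨fun h => Bool.noConfusion h, fun h => absurd h (hG.tri h2 a23)⟩
    · exact ⟨fun h => Bool.noConfusion h, fun h => absurd h (hG.tri h0 a04)⟩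
  have hI := child_sound hG (h.root hG (by decide)) 5 [] x hx t5
  have hu6 : ∀ i < 6, u ≠ updF f 5 x i := fresh_upd (fun i hi => (hu' i hi).1) hux.ne
  have t6 : Tr G 6 (updF f 5 x) u 32 := by
    refine Tr.mk' (by decide) fun j hj => ?_
    by_cases hj5 : j = 5
    · rw [hj5, updF_self]; exact ⟨fun _ => hux, fun _ => rfl⟩
    · rw [updF_ne _ _ hj5]
      have key : ∀ j < 5, Nat.testBit 32 j = false := by decide
      rw [key j (by omega)]
      exact ⟨fun h => Bool.noConfusion h, fun h => absurd h (hu' j (by omega)).2⟩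
  have hI2 := child_sound hG hI 32 [] u hu6 t6
  exact no_rows7 hG (f := updF (updF f 5 x) 6 u) hI2.cfg

lemma final_aux [Fintype V] {G : SimpleGraph V} (hG : Ctx G) {c : Fin 5 → V} (hc : GoodC5 G c)
    (i : Fin 5) (x u : V) (h0 : G.Adj x (c i)) (h2 : G.Adj x (c (i + 2)))
    (hu : u ∈ unc G c) (hux : G.Adj u x) : False := by
  let f : ℕ → V := fun k => c (i + Fin.ofNat 5 k)
  have hr : ∀ i j : Fin 5, ∃ k < 5, i + Fin.ofNat 5 k = j := by decide
  have hunc : uncM G f 31 = unc G c := by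
    ext v
    constructor
    · intro hv j
      obtain ⟨k, hk, rfl⟩ := hr i j
      exact hv k ((bits31 k).2 hk)
    · intro hv k _
      exact hv _
  have hadj := hc.1.2
  have hstep : ∀ k l : ℕ, (∀ i : Fin 5, i + Fin.ofNat 5 k + 1 = i + Fin.ofNat 5 l) →
      G.Adj (f k) (f l) := by
    intro k l h
    have := hadj (i + Fin.ofNat 5 k)
    rw [h i] at this
    exact this
  have h5 : Cfg G [31] rows5 f := by
    refine cfg5 hG f ?_ ?_ ?_ ?_ ?_ ?_ ?_
    · intro k hk l hl hkl
      have h1 := hc.1.1 hkl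
      have key : ∀ i : Fin 5, ∀ k < 5, ∀ l < 5,
        i + Fin.ofNat 5 k = i + Fin.ofNat 5 l → k = l := by decide
      exact key i k hk l hl h1
    · exact hstep 0 1 (by decide)
    · exact hstep 1 2 (by decide)
    · exact hstep 2 3 (by decide)
    · exact hstep 3 4 (by decide)
    · exact hstep 4 0 (by decide)
    · intro D hD
      rw [hunc]
      exact good_unc hG hc D hD
  refine no_nbr hG h5 x u ?_ ?_ (hunc ▸ hu) hux
  · have e : ∀ i : Fin 5, i + Fin.ofNat 5 0 = i := by decide
    simpa only [f, e i] using h0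
  · exact h2

end FK

theorem minCex_common_nbr_not_adj_second_nbhd {V : Type} [Fintype V]
    (G : SimpleGraph V) (hG : MinCex G) (c : Fin 5 → V) (hc : GoodC5 G c)
    (i j : Fin 5) (hij : c i ≠ c j) (hnadj : ¬ G.Adj (c i) (c j))
    (x : V) (hxi : G.Adj (c i) x) (hxj : G.Adj (c j) x)
    (u : V) (hu : distC G c u = 2) :
    ¬ G.Adj x u := by
  intro hxu
  have hC := FK.ctx_of_minCex hG
  have hu' : u ∈ FK.unc G c := (FK.two_le_distC_iff hC c u).1 hu.ge
  have h1 : i ≠ j := fun h => hij (h ▸ rfl)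
  have h2 : j ≠ i + 1 := fun h => hnadj (h ▸ hc.1.2 i)
  have h3 : i ≠ j + 1 := fun h => hnadj (h ▸ (hc.1.2 j).symm)
  have key : ∀ i j : Fin 5, i ≠ j → j ≠ i + 1 → i ≠ j + 1 → j = i + 2 ∨ i = j + 2 := by decide
  rcases key i j h1 h2 h3 with h | h
  · subst h
    exact FK.final_aux hC hc i x u hxi.symm hxj.symm hu' hxu.symm
  · subst h
    exact FK.final_aux hC hc j x u hxj.symm hxi.symm hu' hxu.symm
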